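/- arXiv:2112.04048 — 16 statements merged into one kernel-verified Lean document; each statement's English description precedes it below -/
import Mathlib

section
/- Let (q_n)_{n≥1} be a sequence of positive rationals, and let (p_n)_{n≥1} be a sequence of prime numbers such that for every n, p_n divides d(q_n) but p_n does not divide d(q_k) for every k ≠ n. Then the Puiseux monoid M generated by {q_n : n ∈ ℕ} is atomic with 𝒜(M) = {q_n : n ∈ ℕ}. -/
/-- A Puiseux monoid: an additive submonoid of `ℚ` consisting of nonnegative rationals. -/
def IsPuiseux (M : AddSubmonoid ℚ) : Prop := ∀ x ∈ M, 0 ≤ x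

/-- `a` is an atom of the Puiseux monoid `M`. -/
def PMAtom (M : AddSubmonoid ℚ) (a : ℚ) : Prop :=
  a ∈ M ∧ a ≠ 0 ∧ ∀ q r : ℚ, q ∈ M → r ∈ M → a = q + r → q = 0 ∨ r = 0

/-- `M` is atomic: every nonzero element is a finite sum (multiset) of atoms. -/
def PMAtomic (M : AddSubmonoid ℚ) : Prop :=
  ∀ x ∈ M, x ≠ 0 → ∃ s : Multiset ℚ, (∀ a ∈ s, PMAtom M a) ∧ s.sum = x

/-- Weak reciprocal Puiseux monoid: generated by `{1 / d n}` for a strictly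
increasing sequence of positive integers. -/
def WeakReciprocal (M : AddSubmonoid ℚ) : Prop :=
  ∃ d : ℕ → ℕ, StrictMono d ∧ (∀ n, 0 < d n) ∧
    M = AddSubmonoid.closure {q : ℚ | ∃ n, q = 1 / (d n : ℚ)}

/-- Reciprocal Puiseux monoid: generated by `{1 / d n}` for a strictly increasing
sequence of pairwise relatively prime positive integers. -/
def Reciprocal (M : AddSubmonoid ℚ) : Prop :=
  ∃ d : ℕ → ℕ, StrictMono d ∧ (∀ n, 0 < d n) ∧
    (∀ m n, m ≠ n → Nat.Coprime (d m) (d n)) ∧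
    M = AddSubmonoid.closure {q : ℚ | ∃ n, q = 1 / (d n : ℚ)}

/-- Almost reciprocal Puiseux monoid: generated by `{c n / d n}` where `(d n)` is a
strictly increasing sequence of pairwise relatively prime positive integers and
`(c n)` is a sequence of positive integers with `gcd (c n) (d n) = 1`. -/
def AlmostReciprocal (M : AddSubmonoid ℚ) : Prop :=
  ∃ c d : ℕ → ℕ, StrictMono d ∧ (∀ n, 0 < d n) ∧
    (∀ m n, m ≠ n → Nat.Coprime (d m) (d n)) ∧
    (∀ n, 0 < c n) ∧ (∀ n, Nat.Coprime (c n) (d n)) ∧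
    M = AddSubmonoid.closure {q : ℚ | ∃ n, q = (c n : ℚ) / (d n : ℚ)}

/-- Strongly bounded Puiseux monoid: it has a generating set of positive rationals
whose set of numerators is bounded. -/
def StronglyBounded (M : AddSubmonoid ℚ) : Prop :=
  IsPuiseux M ∧ ∃ S : Set ℚ, (∀ s ∈ S, 0 < s) ∧
    M = AddSubmonoid.closure S ∧ ∃ B : ℤ, ∀ s ∈ S, s.num ≤ B

/-- The principal ideal `q + M`. -/
def PrincipalIdeal (M : AddSubmonoid ℚ) (q : ℚ) : Set ℚ :=
  {x | ∃ m ∈ M, x = q + m}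

/-- `M` satisfies the ascending chain condition on principal ideals. -/
def SatisfiesACCP (M : AddSubmonoid ℚ) : Prop :=
  ∀ q : ℕ → ℚ, (∀ n, q n ∈ M) →
    (∀ n, PrincipalIdeal M (q n) ⊆ PrincipalIdeal M (q (n + 1))) →
    ∃ N, ∀ n, N ≤ n → PrincipalIdeal M (q n) = PrincipalIdeal M (q N)

/-- The set of lengths of factorizations of `x` in `M`: lengths of multisets of
atoms of `M` summing to `x`. -/
def LengthSet (M : AddSubmonoid ℚ) (x : ℚ) : Set ℕ :=
  {ℓ | ∃ s : Multiset ℚ, (∀ a ∈ s, PMAtom M a) ∧ s.sum = x ∧ Multiset.card s = ℓ}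

/-- `M` is a length-finite-factorization monoid: atomic, and for every `x ∈ M` and
every length `ℓ`, there are only finitely many factorizations of `x` of length `ℓ`. -/
def LFFM (M : AddSubmonoid ℚ) : Prop :=
  PMAtomic M ∧ ∀ x ∈ M, ∀ ℓ : ℕ,
    {s : Multiset ℚ | (∀ a ∈ s, PMAtom M a) ∧ s.sum = x ∧ Multiset.card s = ℓ}.Finite

/-- if `(q n)` are positive rationals and `(p n)` primes with
`p n ∣ den (q n)` but `p n ∤ den (q k)` for `k ≠ n`, then `⟨q n⟩` is atomic with
set of atoms `{q n}`. -/
theorem stmt1 (q : ℕ → ℚ) (hq : ∀ n, 0 < q n)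
    (p : ℕ → ℕ) (hp : ∀ n, (p n).Prime)
    (hdvd : ∀ n, p n ∣ (q n).den)
    (hndvd : ∀ n k, k ≠ n → ¬ p n ∣ (q k).den)
    (M : AddSubmonoid ℚ) (hM : M = AddSubmonoid.closure (Set.range q)) :
    PMAtomic M ∧ {a : ℚ | PMAtom M a} = Set.range q := by
  have hmem : ∀ n, q n ∈ M := fun n => hM ▸ AddSubmonoid.subset_closure ⟨n, rfl⟩
  have hnn : ∀ x ∈ M, 0 ≤ x := by
    intro x hx
    rw [hM] at hx
    induction hx using AddSubmonoid.closure_induction with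
    | mem x hx => obtain ⟨k, rfl⟩ := hx; exact (hq k).le
    | zero => exact le_refl _
    | add x y _ _ h1 h2 => exact add_nonneg h1 h2
  have key : ∀ n, ∀ x ∈ M, ¬ p n ∣ x.den ∨ ∃ m ∈ M, x = q n + m := by
    intro n x hx
    rw [hM] at hx
    induction hx using AddSubmonoid.closure_induction with
    | mem x hx =>
      obtain ⟨k, rfl⟩ := hx
      by_cases hk : k = n
      · subst hk
        exact Or.inr ⟨0, M.zero_mem, by simp⟩
      · exact Or.inl (hndvd n k hk)
    | zero =>
      left
      simpa using (hp n).one_lt.ne'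
    | add x y hx hy h1 h2 =>
      rw [← hM] at hx hy
      rcases h1 with h1 | ⟨m, hm, rfl⟩
      · rcases h2 with h2 | ⟨m, hm, rfl⟩
        · left
          intro h
          rcases (hp n).dvd_mul.1 (h.trans (Rat.add_den_dvd x y)) with h | h
          · exact h1 h
          · exact h2 h
        · exact Or.inr ⟨x + m, M.add_mem hx hm, by ring⟩
      · exact Or.inr ⟨m + y, M.add_mem hm hy, by ring⟩
  have hatom : ∀ n, PMAtom M (q n) := by
    intro n
    refine ⟨hmem n, (hq n).ne', ?_⟩
    intro a b ha hb hab
    have ha0 := hnn a ha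
    have hb0 := hnn b hb
    rcases key n a ha with h1 | ⟨m, hm, h⟩
    · rcases key n b hb with h2 | ⟨m, hm, h⟩
      · exfalso
        have h := hdvd n
        rw [hab] at h
        rcases (hp n).dvd_mul.1 (h.trans (Rat.add_den_dvd a b)) with h | h
        · exact h1 h
        · exact h2 h
      · left
        have := hnn m hm
        linarith
    · right
      have := hnn m hm
      linarith
  have hsum : ∀ x ∈ M, ∃ s : Multiset ℚ, (∀ a ∈ s, a ∈ Set.range q) ∧ s.sum = x := by
    intro x hx
    rw [hM] at hx
    exact AddSubmonoid.exists_multiset_of_mem_closure hx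
  refine ⟨?_, ?_⟩
  · intro x hx _
    obtain ⟨s, hs, h⟩ := hsum x hx
    refine ⟨s, fun a ha => ?_, h⟩
    obtain ⟨k, rfl⟩ := hs a ha
    exact hatom k
  · ext a
    constructor
    · rintro ⟨haM, ha0, ha⟩
      obtain ⟨s, hs, h⟩ := hsum a haM
      induction s using Multiset.induction_on with
      | empty => exact absurd h.symm (by simpa using ha0)
      | cons b t _ =>
        obtain ⟨k, rfl⟩ := hs b (Multiset.mem_cons_self _ _)
        rw [Multiset.sum_cons] at h
        have ht : t.sum ∈ M := by
          apply AddSubmonoid.multiset_sum_mem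
          intro c hc
          obtain ⟨j, rfl⟩ := hs c (Multiset.mem_cons_of_mem hc)
          exact hmem j
        rcases ha _ _ (hmem k) ht h.symm with h0 | h0
        · exact absurd h0 (hq k).ne'
        · exact ⟨k, by rw [← h, h0, add_zero]⟩
    · rintro ⟨k, rfl⟩
      exact hatom k
end

section
/- Every almost reciprocal Puiseux monoid is atomic. -/
lemma aux_split (G : Set ℚ) (g x : ℚ) (hx : x ∈ AddSubmonoid.closure G) :
    x ∈ AddSubmonoid.closure (G \ {g}) ∨ ∃ m ∈ AddSubmonoid.closure G, x = g + m := by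
  induction hx using AddSubmonoid.closure_induction with
  | mem y hy =>
    by_cases h : y = g
    · exact Or.inr ⟨0, zero_mem _, by simp [h]⟩
    · exact Or.inl (AddSubmonoid.subset_closure ⟨hy, h⟩)
  | zero => exact Or.inl (zero_mem _)
  | add y z hy hz ihy ihz =>
    rcases ihy with h1 | ⟨m, hm, rfl⟩
    · rcases ihz with h2 | ⟨m, hm, rfl⟩
      · exact Or.inl (add_mem h1 h2)
      · exact Or.inr ⟨y + m, add_mem hy hm, by ring⟩
    · exact Or.inr ⟨m + z, add_mem hm hz, by ring⟩

lemma aux_nonneg (G : Set ℚ) (hG : ∀ g ∈ G, 0 < g) (x : ℚ)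
    (hx : x ∈ AddSubmonoid.closure G) : 0 ≤ x := by
  induction hx using AddSubmonoid.closure_induction with
  | mem y hy => exact (hG y hy).le
  | zero => exact le_rfl
  | add y z hy hz ihy ihz => exact add_nonneg ihy ihz

lemma aux_atom (G : Set ℚ) (hG : ∀ g ∈ G, 0 < g) (g : ℚ) (hg : g ∈ G)
    (hn : g ∉ AddSubmonoid.closure (G \ {g})) : PMAtom (AddSubmonoid.closure G) g := by
  refine ⟨AddSubmonoid.subset_closure hg, (hG g hg).ne', ?_⟩
  intro q r hq hr h
  have hq0 := aux_nonneg G hG q hq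
  have hr0 := aux_nonneg G hG r hr
  rcases aux_split G g q hq with h1 | ⟨m, hm, h1⟩
  · rcases aux_split G g r hr with h2 | ⟨m, hm, h2⟩
    · have h3 := add_mem h1 h2
      rw [← h] at h3
      exact absurd h3 hn
    · have := aux_nonneg G hG m hm
      left; linarith
  · have := aux_nonneg G hG m hm
    right; linarith

/-- every almost reciprocal Puiseux monoid is atomic. -/
theorem stmt2 (M : AddSubmonoid ℚ) (hM : AlmostReciprocal M) : PMAtomic M := by
  obtain ⟨c, d, hd, hd0, hcop, hc0, hcd, rfl⟩ := hM
  set G : Set ℚ := {q : ℚ | ∃ n, q = (c n : ℚ) / (d n : ℚ)} with hGdef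
  have hG : ∀ g ∈ G, 0 < g := by
    rintro g ⟨n, rfl⟩
    have h1 : (0 : ℚ) < c n := by exact_mod_cast hc0 n
    have h2 : (0 : ℚ) < d n := by exact_mod_cast hd0 n
    positivity
  have hden : ∀ n, ((c n : ℚ) / (d n : ℚ)).den = d n := by
    intro n
    have := Rat.den_div_eq_of_coprime (a := (c n : ℤ)) (b := (d n : ℤ))
      (by exact_mod_cast hd0 n) (by simpa using hcd n)
    simp only [Int.cast_natCast] at this
    exact Int.ofNat_inj.mp this
  have hat : ∀ n, 1 < d n → PMAtom (AddSubmonoid.closure G) ((c n : ℚ) / (d n : ℚ)) := by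
    intro n hn
    refine aux_atom G hG _ ⟨n, rfl⟩ ?_
    intro hmem
    have key : ∀ x ∈ AddSubmonoid.closure (G \ {(c n : ℚ) / (d n : ℚ)}),
        Nat.Coprime x.den (d n) := by
      intro x hx
      induction hx using AddSubmonoid.closure_induction with
      | mem y hy =>
        obtain ⟨⟨m, rfl⟩, hne⟩ := hy
        rw [hden]
        refine hcop m n ?_
        rintro rfl
        exact hne rfl
      | zero => simp
      | add y z hy hz ihy ihz =>
        exact Nat.Coprime.coprime_dvd_left (Rat.add_den_dvd y z) (Nat.Coprime.mul_left ihy ihz)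
    have := key _ hmem
    rw [hden, Nat.coprime_self] at this
    omega
  have hpos : ∀ n, n ≠ 0 → 1 < d n := by
    intro n hn
    have := hd (Nat.pos_of_ne_zero hn)
    have := hd0 0
    omega
  have hle : AddSubmonoid.closure G ≤
      AddSubmonoid.closure {a | PMAtom (AddSubmonoid.closure G) a} := by
    rw [AddSubmonoid.closure_le]
    rintro g ⟨n, rfl⟩
    by_cases hn : n = 0
    · subst hn
      by_cases h0 : (c 0 : ℚ) / (d 0 : ℚ) ∈ AddSubmonoid.closure (G \ {(c 0 : ℚ) / (d 0 : ℚ)})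
      · refine AddSubmonoid.closure_mono ?_ h0
        rintro _ ⟨⟨m, rfl⟩, hne⟩
        refine hat m (hpos m ?_)
        rintro rfl
        exact hne rfl
      · exact AddSubmonoid.subset_closure (aux_atom G hG _ ⟨0, rfl⟩ h0)
    · exact AddSubmonoid.subset_closure (hat n (hpos n hn))
  intro x hx _
  obtain ⟨s, hs, hsum⟩ := AddSubmonoid.exists_multiset_of_mem_closure (hle hx)
  exact ⟨s, hs, hsum⟩
end

section
/- Let (p_n)_{n≥1} be a strictly increasing sequence of prime numbers and let ℓ be a positive integer. Then the Puiseux monoid M generated by {1/(p_n p_{n+ℓ}) : n ∈ ℕ} is atomic, and every element 1/(p_n p_{n+ℓ}) is an atom of M. -/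
/-- Decomposition predicate: `x = u/(P A) + k c + v/B`. -/
def DecompQ (Q : ℕ → Prop) (P : ℕ) (c : ℚ) (k : ℕ) (x : ℚ) : Prop :=
  ∃ A B u v : ℕ, 0 < A ∧ 0 < B ∧ (∀ q, q.Prime → q ∣ A → Q q) ∧
    (∀ q, q.Prime → q ∣ B → ¬ Q q ∧ q ≠ P) ∧
    x = u / ((P : ℚ) * A) + k * c + v / (B : ℚ)

theorem DecompQ.add {Q : ℕ → Prop} {P : ℕ} {c : ℚ} {k l : ℕ} {x y : ℚ} (hP : 0 < P)
    (hx : DecompQ Q P c k x) (hy : DecompQ Q P c l y) : DecompQ Q P c (k + l) (x + y) := by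
  obtain ⟨A, B, u, v, hA, hB, hQA, hQB, rfl⟩ := hx
  obtain ⟨A', B', u', v', hA', hB', hQA', hQB', rfl⟩ := hy
  refine ⟨A * A', B * B', u * A' + u' * A, v * B' + v' * B, Nat.mul_pos hA hA',
    Nat.mul_pos hB hB', ?_, ?_, ?_⟩
  · intro q hq h
    rcases (hq.dvd_mul).1 h with h | h
    · exact hQA q hq h
    · exact hQA' q hq h
  · intro q hq h
    rcases (hq.dvd_mul).1 h with h | h
    · exact hQB q hq h
    · exact hQB' q hq h
  · have : (P : ℚ) ≠ 0 := by positivity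
    have : (A : ℚ) ≠ 0 := by positivity
    have : (B : ℚ) ≠ 0 := by positivity
    have : (A' : ℚ) ≠ 0 := by positivity
    have : (B' : ℚ) ≠ 0 := by positivity
    push_cast
    field_simp
    ring

theorem DecompQ.le {Q : ℕ → Prop} {P : ℕ} {c : ℚ} {k : ℕ} {x : ℚ} (hc : 0 ≤ c) (hk : 0 < k)
    (hx : DecompQ Q P c k x) : c ≤ x := by
  obtain ⟨A, B, u, v, hA, hB, hQA, hQB, rfl⟩ := hx
  have h1 : (0 : ℚ) ≤ u / ((P : ℚ) * A) := by positivity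
  have h2 : (0 : ℚ) ≤ v / (B : ℚ) := by positivity
  have h3 : (1 : ℚ) ≤ k := by exact_mod_cast hk
  nlinarith

theorem DecompQ.false {Q : ℕ → Prop} {p P : ℕ} (hp : p.Prime) (hP : P.Prime) (hQ : ¬ Q p)
    {c : ℚ} (h : DecompQ Q P c 0 (1 / ((p : ℚ) * P))) : False := by
  obtain ⟨A, B, u, v, hA, hB, hQA, hQB, h⟩ := h
  have hp0 := hp.pos
  have hP0 := hP.pos
  have e : A * B = u * (p * B) + v * p * P * A := by
    have : (P : ℚ) ≠ 0 := by positivity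
    have : (p : ℚ) ≠ 0 := by positivity
    have : (A : ℚ) ≠ 0 := by positivity
    have : (B : ℚ) ≠ 0 := by positivity
    have : (A : ℚ) * B = u * (p * B) + v * p * P * A := by
      push_cast at h
      field_simp at h
      linarith
    exact_mod_cast this
  have hAp : Nat.Coprime A p := by
    rw [Nat.coprime_comm, hp.coprime_iff_not_dvd]
    exact fun hd => hQ (hQA p hp hd)
  have hAB : Nat.Coprime A B :=
    Nat.coprime_of_dvd fun q hq h1 h2 => (hQB q hq h2).1 (hQA q hq h1)
  have hd : A ∣ u * (p * B) := by
    refine (Nat.dvd_add_left (Dvd.intro_left (v * p * P) rfl)).1 ?_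
    exact e ▸ Dvd.intro _ rfl
  obtain ⟨w, rfl⟩ := (Nat.Coprime.mul_right hAp hAB).dvd_of_dvd_mul_right hd
  have e2 : B = w * p * B + v * p * P := by
    apply Nat.eq_of_mul_eq_mul_left hA
    rw [e]; ring
  rcases Nat.eq_zero_or_pos w with rfl | hw
  · refine (hQB P hP ?_).2 rfl
    rw [e2]; simp
  · have := hp.two_le
    have h2 : 2 ≤ w * p := by nlinarith
    have : 2 * B ≤ w * p * B := Nat.mul_le_mul_right _ h2
    omega

/-- for a strictly increasing sequence of primes `(p n)` and `ℓ ≥ 1`,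
the Puiseux monoid generated by `{1 / (p n * p (n + ℓ))}` is atomic, and each
generator is an atom. -/
theorem stmt3 (p : ℕ → ℕ) (hmono : StrictMono p) (hp : ∀ n, (p n).Prime)
    (ℓ : ℕ) (hℓ : 0 < ℓ) (M : AddSubmonoid ℚ)
    (hM : M = AddSubmonoid.closure
      {q : ℚ | ∃ n, q = 1 / ((p n : ℚ) * (p (n + ℓ) : ℚ))}) :
    PMAtomic M ∧ ∀ n, PMAtom M (1 / ((p n : ℚ) * (p (n + ℓ) : ℚ))) := by
  have hpos : ∀ n, 0 < p n := fun n => (hp n).pos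
  have hinj := hmono.injective
  have hnn : ∀ x ∈ M, 0 ≤ x := by
    intro x hx
    rw [hM] at hx
    induction hx using AddSubmonoid.closure_induction with
    | mem x hx => obtain ⟨n, rfl⟩ := hx; positivity
    | zero => exact le_rfl
    | add x y _ _ hx hy => exact add_nonneg hx hy
  have key : ∀ n, PMAtom M (1 / ((p n : ℚ) * (p (n + ℓ) : ℚ))) := by
    intro n
    set c : ℚ := 1 / ((p n : ℚ) * (p (n + ℓ) : ℚ)) with hc
    have hcpos : 0 < c := by
      have := hpos n
      have := hpos (n + ℓ)
      positivity
    let Q : ℕ → Prop := fun q => ∃ t, q = p (n + (t + 2) * ℓ)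
    have hdec : ∀ x ∈ M, ∃ k, DecompQ Q (p (n + ℓ)) c k x := by
      intro x hx
      rw [hM] at hx
      induction hx using AddSubmonoid.closure_induction with
      | zero =>
        refine ⟨0, 1, 1, 0, 0, one_pos, one_pos, ?_, ?_, by simp⟩
        · intro q hq h
          exact absurd (Nat.dvd_one.1 h) hq.one_lt.ne'
        · intro q hq h
          exact absurd (Nat.dvd_one.1 h) hq.one_lt.ne'
      | add x y _ _ hx hy =>
        obtain ⟨k, hk⟩ := hx
        obtain ⟨l, hl⟩ := hy
        exact ⟨k + l, hk.add (hpos _) hl⟩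
      | mem x hx =>
        obtain ⟨i, rfl⟩ := hx
        have h1 := hpos i
        have h2 := hpos (i + ℓ)
        have h3 := hpos (n + ℓ)
        have n1 : (p i : ℚ) ≠ 0 := by positivity
        have n2 : (p (i + ℓ) : ℚ) ≠ 0 := by positivity
        have n3 : (p (n + ℓ) : ℚ) ≠ 0 := by positivity
        by_cases hi : ∃ t, i = n + t * ℓ
        · obtain ⟨t, ht⟩ := hi
          match t, ht with
          | 0, ht =>
            have : i = n := by simpa using ht
            subst this
            refine ⟨1, 1, 1, 0, 0, one_pos, one_pos, ?_, ?_, by simp [hc]⟩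
            · intro q hq h
              exact absurd (Nat.dvd_one.1 h) hq.one_lt.ne'
            · intro q hq h
              exact absurd (Nat.dvd_one.1 h) hq.one_lt.ne'
          | 1, ht =>
            have : i = n + ℓ := by simpa using ht
            subst this
            refine ⟨0, p (n + ℓ + ℓ), 1, 1, 0, h2, one_pos, ?_, ?_, by simp⟩
            · intro q hq h
              refine ⟨0, ?_⟩
              rw [(Nat.prime_dvd_prime_iff_eq hq (hp _)).1 h]
              congr 1; ring
            · intro q hq h
              exact absurd (Nat.dvd_one.1 h) hq.one_lt.ne'
          | t + 2, ht =>
            refine ⟨0, p i * p (i + ℓ), 1, p (n + ℓ), 0, Nat.mul_pos h1 h2, one_pos, ?_, ?_, ?_⟩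
            · intro q hq h
              rcases (hq.dvd_mul).1 h with h | h
              · exact ⟨t, by rw [(Nat.prime_dvd_prime_iff_eq hq (hp _)).1 h, ht]⟩
              · refine ⟨t + 1, ?_⟩
                rw [(Nat.prime_dvd_prime_iff_eq hq (hp _)).1 h, ht]
                congr 1; ring
            · intro q hq h
              exact absurd (Nat.dvd_one.1 h) hq.one_lt.ne'
            · push_cast
              field_simp
              simp
        · refine ⟨0, 1, p i * p (i + ℓ), 0, 1, one_pos, Nat.mul_pos h1 h2, ?_, ?_, by simp⟩
          · intro q hq h
            exact absurd (Nat.dvd_one.1 h) hq.one_lt.ne'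
          · intro q hq h
            rcases (hq.dvd_mul).1 h with h | h
            · rw [(Nat.prime_dvd_prime_iff_eq hq (hp _)).1 h]
              refine ⟨?_, fun h => hi ⟨1, by simpa using hinj h⟩⟩
              rintro ⟨t, ht⟩
              exact hi ⟨t + 2, hinj ht⟩
            · rw [(Nat.prime_dvd_prime_iff_eq hq (hp _)).1 h]
              refine ⟨?_, fun h => hi ⟨0, by simpa using hinj h⟩⟩
              rintro ⟨t, ht⟩
              refine hi ⟨t + 1, ?_⟩
              have := hinj ht
              have e : n + (t + 2) * ℓ = n + (t + 1) * ℓ + ℓ := by ring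
              omega
    refine ⟨?_, hcpos.ne', ?_⟩
    · rw [hM]
      exact AddSubmonoid.subset_closure ⟨n, rfl⟩
    · intro q r hq hr hqr
      obtain ⟨k, hk⟩ := hdec q hq
      obtain ⟨l, hl⟩ := hdec r hr
      have hq0 := hnn q hq
      have hr0 := hnn r hr
      rcases Nat.eq_zero_or_pos k with rfl | hk0
      · rcases Nat.eq_zero_or_pos l with rfl | hl0
        · exfalso
          have h := hk.add (hpos _) hl
          rw [← hqr] at h
          refine DecompQ.false (hp n) (hp (n + ℓ)) ?_ h
          rintro ⟨t, ht⟩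
          have := hinj ht
          have : 0 < (t + 2) * ℓ := by positivity
          omega
        · left
          have := hl.le hcpos.le hl0
          linarith
      · right
        have := hk.le hcpos.le hk0
        linarith
  refine ⟨?_, key⟩
  intro x hx _
  rw [hM] at hx
  obtain ⟨s, hs, hsum⟩ := AddSubmonoid.exists_multiset_of_mem_closure hx
  refine ⟨s, fun a ha => ?_, hsum⟩
  obtain ⟨n, rfl⟩ := hs a ha
  exact key n
end

section
/- Let (p_n)_{n≥1} be the strictly increasing enumeration of the odd primes, and let M be the Grams' monoid, i.e., the Puiseux monoid generated by {1/(2^n p_n) : n ∈ ℕ}. Then M is not isomorphic (as an additive monoid) to any reciprocal Puiseux monoid. -/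
/-- the Grams' monoid `⟨1 / (2 ^ n * p n)⟩`, where `(p n)` is the
strictly increasing enumeration of the odd primes, is not isomorphic to any
reciprocal Puiseux monoid. -/
theorem stmt5 (p : ℕ → ℕ) (hmono : StrictMono p)
    (hp : ∀ n, (p n).Prime ∧ p n ≠ 2)
    (hsurj : ∀ r : ℕ, r.Prime → r ≠ 2 → ∃ n, p n = r)
    (M : AddSubmonoid ℚ)
    (hM : M = AddSubmonoid.closure
      {x : ℚ | ∃ n : ℕ, x = 1 / ((2 : ℚ) ^ (n + 1) * (p n : ℚ))}) :
    ¬ ∃ N : AddSubmonoid ℚ, Reciprocal N ∧ Nonempty (↥M ≃+ ↥N) := by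
  rintro ⟨N, ⟨d, hd, hpos, hco, hN⟩, ⟨φ⟩⟩
  -- bounded power of two in the denominators of `d`
  have hk : ∃ k : ℕ, ∀ n, ∃ D : ℕ, Odd D ∧ d n ∣ 2 ^ k * D := by
    by_cases h : ∃ m, Even (d m)
    · obtain ⟨m, hm⟩ := h
      obtain ⟨k, D, hD, e⟩ := Nat.exists_eq_two_pow_mul_odd (hpos m).ne'
      refine ⟨k, fun n => ?_⟩
      by_cases hn : m = n
      · subst hn
        exact ⟨D, hD, by rw [e]⟩
      · refine ⟨d n, ?_, Dvd.intro_left _ rfl⟩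
        rw [← Nat.not_even_iff_odd]
        intro h2
        have h3 := Nat.dvd_gcd hm.two_dvd h2.two_dvd
        rw [hco m n hn] at h3
        norm_num at h3
    · push Not at h
      exact ⟨0, fun n => ⟨d n, by rw [← Nat.not_even_iff_odd]; simpa using h n, by simp⟩⟩
  obtain ⟨k, hk⟩ := hk
  have key : ∀ x ∈ N, ∃ D : ℕ, Odd D ∧ ∃ a : ℤ, (2 : ℚ) ^ k * D * x = a := by
    intro x hx
    rw [hN] at hx
    induction hx using AddSubmonoid.closure_induction with
    | mem x hx =>
      obtain ⟨n, rfl⟩ := hx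
      obtain ⟨D, hD, c, hc⟩ := hk n
      refine ⟨D, hD, c, ?_⟩
      have h0 : (d n : ℚ) ≠ 0 := by exact_mod_cast (hpos n).ne'
      have hc' : (2 : ℚ) ^ k * D = d n * c := by exact_mod_cast hc
      rw [hc']
      field_simp
      simp
    | zero => exact ⟨1, odd_one, 0, by simp⟩
    | add x y _ _ hx hy =>
      obtain ⟨D, hD, a, ha⟩ := hx
      obtain ⟨E, hE, b, hb⟩ := hy
      refine ⟨D * E, hD.mul hE, E * a + D * b, ?_⟩
      push_cast
      rw [← ha, ← hb]
      ring
  have hg : ∀ n : ℕ, (1 : ℚ) / ((2 : ℚ) ^ (n + 1) * (p n : ℚ)) ∈ M := fun n => by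
    rw [hM]; exact AddSubmonoid.subset_closure ⟨n, rfl⟩
  have hp0 : ∀ n, (p n : ℚ) ≠ 0 := fun n => by exact_mod_cast (hp n).1.ne_zero
  have hu : ∀ n : ℕ, (1 : ℚ) / (2 : ℚ) ^ (n + 1) ∈ M := fun n => by
    have h := M.nsmul_mem (hg n) (p n)
    have e : p n • ((1 : ℚ) / ((2 : ℚ) ^ (n + 1) * (p n : ℚ))) = 1 / (2 : ℚ) ^ (n + 1) := by
      have := hp0 n
      rw [nsmul_eq_mul]
      field_simp
    rwa [e] at h
  have h1 : (1 : ℚ) ∈ M := by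
    have h := M.nsmul_mem (hu 0) 2
    norm_num at h
    exact h
  have hrel : ∀ n : ℕ, (2 ^ (n + 1) : ℕ) • (⟨_, hu n⟩ : M) = ⟨1, h1⟩ := fun n => by
    apply Subtype.ext
    simp
  obtain ⟨y, hy⟩ : ∃ y : ℚ, y = (φ ⟨1, h1⟩ : N) := ⟨_, rfl⟩
  have hy0 : y ≠ 0 := by
    intro h
    rw [h] at hy
    have h2 : φ ⟨1, h1⟩ = 0 := Subtype.ext hy.symm
    rw [map_eq_zero_iff φ φ.injective] at h2
    have := congrArg Subtype.val h2
    simp at this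
  set n := 2 ^ k * y.num.natAbs with hn
  have hz := (φ ⟨_, hu n⟩).2
  have hzy : (2 : ℚ) ^ (n + 1) * (φ ⟨_, hu n⟩ : N) = y := by
    rw [hy, ← hrel n, map_nsmul]
    simp
  obtain ⟨D, hD, a, ha⟩ := key _ hz
  generalize ((φ ⟨_, hu n⟩ : N) : ℚ) = z at *
  have e1 : ((2 : ℤ) ^ k * y.num) * D = 2 ^ (n + 1) * (a * y.den) := by
    have hyd : (y.den : ℚ) ≠ 0 := by exact_mod_cast y.den_nz
    have : (y.num : ℚ) = y * y.den := (Rat.mul_den_eq_num y).symm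
    have : ((2 : ℚ) ^ k * y.num) * D = 2 ^ (n + 1) * (a * y.den) := by
      rw [this, ← ha]
      nth_rewrite 1 [← hzy]
      ring
    exact_mod_cast this
  have e2 : 2 ^ (n + 1) ∣ n * D := by
    have := congrArg Int.natAbs e1
    simp only [Int.natAbs_mul, Int.natAbs_pow] at this
    exact ⟨_, this⟩
  have e3 : 2 ^ (n + 1) ∣ n :=
    Nat.Coprime.dvd_of_dvd_mul_right
      (Nat.Coprime.pow_left _ (Nat.coprime_two_left.mpr hD)) e2
  have hn0 : 0 < n := by
    rw [hn]
    have := Int.natAbs_pos.mpr (Rat.num_ne_zero.mpr hy0)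
    positivity
  have := Nat.le_of_dvd hn0 e3
  have := Nat.lt_two_pow_self (n := n + 1)
  omega
end

section
/- Let M be the Puiseux monoid generated by {(p+1)/p : p prime}. Then M is not isomorphic (as an additive monoid) to any strongly bounded Puiseux monoid; in particular, M is not isomorphic to any weak reciprocal Puiseux monoid. -/
lemma aux_M (x : ℚ) (hx : x ∈ AddSubmonoid.closure
      {x : ℚ | ∃ p : ℕ, p.Prime ∧ x = ((p : ℚ) + 1) / (p : ℚ)}) : x = 0 ∨ 1 < x := by
  induction hx using AddSubmonoid.closure_induction with
  | mem x hx =>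
    obtain ⟨p, hp, rfl⟩ := hx
    have : (0 : ℚ) < p := by exact_mod_cast hp.pos
    right
    rw [lt_div_iff₀ this]
    linarith
  | zero => left; rfl
  | add x y _ _ h1 h2 =>
    rcases h1 with h1 | h1 <;> rcases h2 with h2 | h2
    · left; linarith
    · right; linarith
    · right; linarith
    · right; linarith

lemma aux_S (S : Set ℚ) (c : ℚ)
    (h : ∀ y ∈ AddSubmonoid.closure S, y = 0 ∨ c < y) (x : ℚ)
    (hx : x ∈ AddSubmonoid.closure S) : x = 0 ∨ x ∈ S ∨ 2 * c < x := by
  induction hx using AddSubmonoid.closure_induction with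
  | mem x hx => right; left; exact hx
  | zero => left; rfl
  | add x y hx hy h1 h2 =>
    rcases h x hx with h3 | h3
    · subst h3; simpa using h2
    · rcases h y hy with h4 | h4
      · subst h4; simpa using h1
      · right; right; linarith

lemma aux_hom (M N : AddSubmonoid ℚ) (f : ↥M ≃+ ↥N) (hM : ∀ x ∈ M, 0 ≤ x)
    (a b : M) : (f a : ℚ) * b = f b * a := by
  have key : ((a : ℚ).den * (b : ℚ).num.toNat) • a = ((b : ℚ).den * (a : ℚ).num.toNat) • b := by
    have ha : (((a : ℚ).num.toNat : ℕ) : ℚ) = (a : ℚ).num := by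
      exact_mod_cast Int.toNat_of_nonneg (Rat.num_nonneg.2 (hM _ a.2))
    have hb : (((b : ℚ).num.toNat : ℕ) : ℚ) = (b : ℚ).num := by
      exact_mod_cast Int.toNat_of_nonneg (Rat.num_nonneg.2 (hM _ b.2))
    apply Subtype.ext
    simp only [AddSubmonoidClass.coe_nsmul, nsmul_eq_mul, Nat.cast_mul]
    rw [ha, hb]
    have h1 := Rat.mul_den_eq_num (a : ℚ)
    have h2 := Rat.mul_den_eq_num (b : ℚ)
    rw [← h1, ← h2]; ring
  by_cases hb0 : (b : ℚ) = 0
  · have : b = 0 := Subtype.ext hb0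
    subst this; simp
  have h3 := congrArg (fun z => ((f z : N) : ℚ)) key
  have h4 := congrArg (fun z => ((z : M) : ℚ)) key
  simp only [map_nsmul, AddSubmonoidClass.coe_nsmul, nsmul_eq_mul] at h3 h4
  have hpos : (((a : ℚ).den * (b : ℚ).num.toNat : ℕ) : ℚ) ≠ 0 := by
    have : 0 < (b : ℚ).num := Rat.num_pos.2 (lt_of_le_of_ne (hM _ b.2) (Ne.symm hb0))
    have h5 := (a : ℚ).den_pos
    have : 0 < (b : ℚ).num.toNat := by omega
    have := Nat.mul_pos h5 this
    exact_mod_cast this.ne'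
  apply mul_left_cancel₀ hpos
  linear_combination (b : ℚ) * h3 - (f b : ℚ) * h4

lemma aux_main (M : AddSubmonoid ℚ)
    (hM : M = AddSubmonoid.closure
      {x : ℚ | ∃ p : ℕ, p.Prime ∧ x = ((p : ℚ) + 1) / (p : ℚ)})
    (N : AddSubmonoid ℚ) (hN : StronglyBounded N) (f : ↥M ≃+ ↥N) : False := by
  obtain ⟨hN0, S, -, hNS, B, hB⟩ := hN
  have hM1 : ∀ x ∈ M, x = 0 ∨ 1 < x := fun x hx => aux_M x (hM ▸ hx)
  have hM0 : ∀ x ∈ M, 0 ≤ x := fun x hx => by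
    rcases hM1 x hx with h | h <;> linarith
  have hgen : ∀ p : ℕ, p.Prime → ((p : ℚ) + 1) / (p : ℚ) ∈ M := fun p hp => by
    rw [hM]; exact AddSubmonoid.subset_closure ⟨p, hp, rfl⟩
  let t : M := ⟨_, hgen 2 Nat.prime_two⟩
  have ht : (t : ℚ) = 3 / 2 := by simp only [t]; norm_num
  obtain ⟨c, hc⟩ : ∃ c : ℚ, c = (f t : ℚ) / (3 / 2) := ⟨_, rfl⟩
  have hf : ∀ a : M, (f a : ℚ) = c * a := fun a => by
    have := aux_hom M N f hM0 a t
    rw [ht] at this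
    rw [hc]; linarith
  have hc0 : 0 < c := by
    have h1 := hN0 _ (f t).2
    have h2 : (f t : ℚ) ≠ 0 := by
      intro h
      have : f t = 0 := Subtype.ext h
      have h5 : t = 0 := by simpa using this
      rw [h5] at ht
      norm_num at ht
    have : 0 < (f t : ℚ) := lt_of_le_of_ne h1 (Ne.symm h2)
    rw [hc]; positivity
  have hN1 : ∀ y ∈ AddSubmonoid.closure S, y = 0 ∨ c < y := by
    intro y hy
    rw [← hNS] at hy
    obtain ⟨a, ha⟩ := f.surjective ⟨y, hy⟩
    have h1 := hf a
    rw [ha] at h1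
    simp only at h1
    rcases hM1 _ a.2 with h | h
    · left; rw [h1, h, mul_zero]
    · right; rw [h1]; nlinarith
  obtain ⟨p, hpB, hp⟩ := Nat.exists_infinite_primes (B * c.den).toNat
  have hp0 : (0 : ℚ) < p := by exact_mod_cast hp.pos
  have hp1 : (1 : ℚ) ≤ p := by exact_mod_cast hp.one_lt.le
  obtain ⟨s, hs⟩ : ∃ s : ℚ, s = c * (((p : ℚ) + 1) / p) := ⟨_, rfl⟩
  have hs0 : 0 < s := by rw [hs]; positivity
  have hsN : s ∈ AddSubmonoid.closure S := by
    rw [← hNS, hs, ← hf ⟨_, hgen p hp⟩]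
    exact (f _).2
  have hsS : s ∈ S := by
    rcases aux_S S c hN1 s hsN with h | h | h
    · exact absurd h hs0.ne'
    · exact h
    · exfalso
      have : ((p : ℚ) + 1) / p ≤ 2 := by rw [div_le_iff₀ hp0]; linarith
      rw [hs] at h
      nlinarith
  have hle := hB s hsS
  have hnum : 0 < s.num := Rat.num_pos.2 hs0
  have e : s.num * c.den * p = s.den * c.num * (p + 1) := by
    have h1 := Rat.mul_den_eq_num s
    have h2 := Rat.mul_den_eq_num c
    have h3 : s * p = c * (p + 1) := by rw [hs]; field_simp
    have : (s.num : ℚ) * c.den * p = s.den * c.num * (p + 1) := by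
      rw [← h1, ← h2]
      linear_combination (s.den : ℚ) * c.den * h3
    exact_mod_cast this
  have hcop : IsCoprime ((p : ℤ) + 1) p := ⟨1, -1, by ring⟩
  have hdvd : ((p : ℤ) + 1) ∣ s.num * c.den :=
    hcop.dvd_of_dvd_mul_right (Dvd.intro_left _ e.symm)
  have hd : (0 : ℤ) < c.den := by exact_mod_cast c.den_pos
  have h1 := Int.le_of_dvd (mul_pos hnum hd) hdvd
  have h2 : s.num * c.den ≤ B * c.den := by gcongr
  omega

/-- the Puiseux monoid `⟨(p + 1) / p : p prime⟩` is not isomorphic to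
any strongly bounded Puiseux monoid; in particular it is not isomorphic to any weak
reciprocal Puiseux monoid. -/
theorem stmt6 (M : AddSubmonoid ℚ)
    (hM : M = AddSubmonoid.closure
      {x : ℚ | ∃ p : ℕ, p.Prime ∧ x = ((p : ℚ) + 1) / (p : ℚ)}) :
    (¬ ∃ N : AddSubmonoid ℚ, StronglyBounded N ∧ Nonempty (↥M ≃+ ↥N)) ∧
    (¬ ∃ N : AddSubmonoid ℚ, WeakReciprocal N ∧ Nonempty (↥M ≃+ ↥N)) := by
  refine ⟨?_, ?_⟩
  · rintro ⟨N, hN, ⟨f⟩⟩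
    exact aux_main M hM N hN f
  · rintro ⟨N, ⟨d, -, hd, rfl⟩, ⟨f⟩⟩
    have hpos : ∀ s ∈ {q : ℚ | ∃ n, q = 1 / (d n : ℚ)}, 0 < s := by
      rintro s ⟨n, rfl⟩
      have : (0 : ℚ) < d n := by exact_mod_cast hd n
      positivity
    refine aux_main M hM _ ⟨?_, _, hpos, rfl, 1, ?_⟩ f
    · intro x hx
      induction hx using AddSubmonoid.closure_induction with
      | mem x hx => exact (hpos x hx).le
      | zero => exact le_rfl
      | add x y _ _ h1 h2 => exact add_nonneg h1 h2
    · rintro s ⟨n, rfl⟩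
      have := hd n
      rw [one_div, Rat.inv_natCast_num_of_pos this]
end

section
/- Let G be a nontrivial additive subgroup of ℚ. Then the monoid G_{≥0} of nonnegative elements of G is not isomorphic (as an additive monoid) to any almost reciprocal Puiseux monoid. -/
lemma aux8 (c d : ℕ → ℕ) (hd : ∀ n, 0 < d n) (hc : ∀ n, 0 < c n)
    (hco : ∀ m n, m ≠ n → Nat.Coprime (d m) (d n)) (hcd : ∀ n, Nat.Coprime (c n) (d n))
    (m n : ℕ) (hmn : m ≠ n) (hm : 1 < d m) (z : ℚ)
    (hz : z ∈ AddSubmonoid.closure {q : ℚ | ∃ n, q = (c n : ℚ) / (d n : ℚ)})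
    (h : (c m : ℚ) / (d m : ℚ) = (c n : ℚ) / (d n : ℚ) + z) : False := by
  have hden : ∀ i, ((c i : ℚ) / (d i : ℚ)).den = d i := by
    intro i
    have := Rat.den_div_eq_of_coprime (a := (c i : ℤ)) (b := (d i : ℤ))
      (by exact_mod_cast hd i) (by simpa using hcd i)
    rw [Int.cast_natCast, Int.cast_natCast] at this
    exact Int.natCast_inj.1 this
  have hpos : ∀ i, 0 < (c i : ℚ) / (d i : ℚ) := fun i =>
    div_pos (by exact_mod_cast hc i) (by exact_mod_cast hd i)
  have hadd : ∀ r s : ℚ, Nat.Coprime (d m) r.den → Nat.Coprime (d m) s.den →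
      Nat.Coprime (d m) (r + s).den := fun r s hr hs =>
    Nat.Coprime.coprime_dvd_right (Rat.add_den_dvd r s) (Nat.Coprime.mul_right hr hs)
  have key : ∃ (k : ℕ) (r : ℚ), 0 ≤ r ∧ Nat.Coprime (d m) r.den ∧
      z = k * ((c m : ℚ) / (d m : ℚ)) + r := by
    clear h
    induction hz using AddSubmonoid.closure_induction with
    | mem x hx =>
      obtain ⟨i, rfl⟩ := hx
      by_cases hi : m = i
      · subst hi
        exact ⟨1, 0, le_rfl, by simp, by simp⟩
      · exact ⟨0, _, (hpos i).le, by rw [hden]; exact hco m i hi, by simp⟩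
    | zero => exact ⟨0, 0, le_rfl, by simp, by simp⟩
    | add x y _ _ hx hy =>
      obtain ⟨k, r, hr, hr', rfl⟩ := hx
      obtain ⟨l, s, hs, hs', rfl⟩ := hy
      exact ⟨k + l, r + s, add_nonneg hr hs, hadd r s hr' hs', by push_cast; ring⟩
  obtain ⟨k, r, hr, hr', rfl⟩ := key
  rcases Nat.eq_zero_or_pos k with rfl | hk
  · have h2 := hadd _ _ (show Nat.Coprime (d m) ((c n : ℚ) / (d n : ℚ)).den by
      rw [hden]; exact hco m n hmn) hr'
    have h3 : (c m : ℚ) / (d m : ℚ) = (c n : ℚ) / (d n : ℚ) + r := by simpa using h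
    rw [← h3, hden, Nat.coprime_self] at h2
    omega
  · have h1 : (1 : ℚ) ≤ k := by exact_mod_cast hk
    have := mul_le_mul_of_nonneg_right h1 (hpos m).le
    have := hpos n
    linarith

/-- for a nontrivial additive subgroup `G` of `ℚ`, the monoid `G_{≥0}`
is not isomorphic to any almost reciprocal Puiseux monoid. -/
theorem stmt8 (G : AddSubgroup ℚ) (hG : G ≠ ⊥) (M : AddSubmonoid ℚ)
    (hM : ∀ x : ℚ, x ∈ M ↔ x ∈ G ∧ 0 ≤ x) :
    ¬ ∃ N : AddSubmonoid ℚ, AlmostReciprocal N ∧ Nonempty (↥M ≃+ ↥N) := by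
  rintro ⟨N, ⟨c, d, hmono, hd, hco, hc, hcd, rfl⟩, ⟨e⟩⟩
  have h01 : d 0 < d 1 := hmono (by norm_num)
  have h12 : d 1 < d 2 := hmono (by norm_num)
  have h0 := hd 0
  let a : ℕ → AddSubmonoid.closure {q : ℚ | ∃ n, q = (c n : ℚ) / (d n : ℚ)} := fun i =>
    ⟨(c i : ℚ) / (d i : ℚ), AddSubmonoid.subset_closure ⟨i, rfl⟩⟩
  have main : ∀ m n : ℕ, m ≠ n → 1 < d m →
      ((e.symm (a n) : M) : ℚ) ≤ ((e.symm (a m) : M) : ℚ) → False := by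
    intro m n hmn hm hle
    have hw : ((e.symm (a m) : M) : ℚ) - ((e.symm (a n) : M) : ℚ) ∈ M :=
      (hM _).2 ⟨G.sub_mem ((hM _).1 (e.symm (a m)).2).1 ((hM _).1 (e.symm (a n)).2).1,
        sub_nonneg.2 hle⟩
    have h1 : e.symm (a m) = e.symm (a n) + ⟨_, hw⟩ := by
      apply Subtype.ext
      simp
    have h2 := congrArg e h1
    rw [map_add, e.apply_symm_apply, e.apply_symm_apply] at h2
    exact aux8 c d hd hc hco hcd m n hmn hm _ (e ⟨_, hw⟩).2 (congrArg Subtype.val h2)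
  rcases le_total ((e.symm (a 1) : M) : ℚ) ((e.symm (a 2) : M) : ℚ) with h | h
  · exact main 2 1 (by norm_num) (by omega) h
  · exact main 1 2 (by norm_num) (by omega) h
end

section
/- Every Puiseux monoid can be embedded (via an injective additive monoid homomorphism) into a weak reciprocal Puiseux monoid. -/
/-- every Puiseux monoid embeds, via an injective additive monoid
homomorphism, into a weak reciprocal Puiseux monoid. -/
theorem stmt9 (M : AddSubmonoid ℚ) (hM : IsPuiseux M) :
    ∃ N : AddSubmonoid ℚ, WeakReciprocal N ∧
      ∃ f : ↥M →+ ↥N, Function.Injective f := by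
  refine ⟨AddSubmonoid.closure {q : ℚ | ∃ n : ℕ, q = 1 / (((fun k : ℕ => k + 1) n : ℕ) : ℚ)},
    ⟨fun k => k + 1, fun a b h => Nat.succ_lt_succ h, fun n => Nat.succ_pos n, rfl⟩, ?_⟩
  have hle : M ≤ AddSubmonoid.closure
      {q : ℚ | ∃ n : ℕ, q = 1 / (((fun k : ℕ => k + 1) n : ℕ) : ℚ)} := by
    intro x hx
    have h0 := hM x hx
    have hnum : 0 ≤ x.num := Rat.num_nonneg.mpr h0
    have hgen : (1 / (x.den : ℚ)) ∈ AddSubmonoid.closure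
        {q : ℚ | ∃ n : ℕ, q = 1 / (((fun k : ℕ => k + 1) n : ℕ) : ℚ)} := by
      apply AddSubmonoid.subset_closure
      refine ⟨x.den - 1, ?_⟩
      have : x.den - 1 + 1 = x.den := Nat.succ_pred_eq_of_pos x.den_pos
      simp only [this]
    have h := AddSubmonoid.nsmul_mem _ hgen x.num.toNat
    have hxe : x.num.toNat • (1 / (x.den : ℚ)) = x := by
      have h1 : ((x.num.toNat : ℕ) : ℚ) = (x.num : ℚ) := by
        exact_mod_cast Int.toNat_of_nonneg hnum
      rw [nsmul_eq_mul, h1, mul_one_div, Rat.num_div_den]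
    rwa [hxe] at h
  exact ⟨AddSubmonoid.inclusion hle, AddSubmonoid.inclusion_injective hle⟩
end

section
/- Let q be a positive rational number that is not a positive integer, and let M_q be the Puiseux monoid generated by {q^n : n ∈ ℕ}. Then M_q is not contained in (equivalently, cannot be embedded as a submonoid of ℚ into) any almost reciprocal Puiseux monoid. -/
/-- for a positive rational `q` that is not a positive integer, the
Puiseux monoid `⟨q ^ n : n ≥ 1⟩` is not contained in any almost reciprocal Puiseux
monoid. -/
theorem stmt10 (q : ℚ) (hq : 0 < q) (hqn : ¬ ∃ m : ℕ, q = (m : ℚ))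
    (M : AddSubmonoid ℚ)
    (hM : M = AddSubmonoid.closure {x : ℚ | ∃ n : ℕ, x = q ^ (n + 1)}) :
    ¬ ∃ N : AddSubmonoid ℚ, AlmostReciprocal N ∧ M ≤ N := by
  rintro ⟨N, ⟨c, d, -, hd, hcop, -, -, hN⟩, hMN⟩
  have hden : q.den ≠ 1 := by
    intro h
    apply hqn
    refine ⟨q.num.toNat, ?_⟩
    have h1 : ((q.num.toNat : ℤ)) = q.num := Int.toNat_of_nonneg (Rat.num_pos.mpr hq).le
    have h2 : ((q.num : ℤ) : ℚ) = q := (Rat.den_eq_one_iff q).mp h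
    rw [← h1] at h2
    exact_mod_cast h2.symm
  obtain ⟨p, hp, hpd⟩ := Nat.exists_prime_and_dvd hden
  haveI : Fact p.Prime := ⟨hp⟩
  have hq1 : 1 < padicNorm p q := by
    have hnum : padicNorm p (q.num : ℚ) = 1 := by
      rw [padicNorm.int_eq_one_iff]
      intro h
      have h' : p ∣ q.num.natAbs := Int.natCast_dvd.mp h
      exact Nat.not_coprime_of_dvd_of_dvd hp.one_lt h' hpd q.reduced
    have hdl : padicNorm p (q.den : ℚ) < 1 := (padicNorm.nat_lt_one_iff _).mpr hpd
    have hd0 : 0 < padicNorm p (q.den : ℚ) :=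
      lt_of_le_of_ne (padicNorm.nonneg _)
        (Ne.symm (padicNorm.nonzero (by exact_mod_cast q.den_nz)))
    rw [← Rat.num_div_den q, padicNorm.div, hnum]
    exact (one_lt_div hd0).mpr hdl
  have hB : ∃ B : ℚ, 1 ≤ B ∧ ∀ n, 1 / padicNorm p (d n : ℚ) ≤ B := by
    by_cases h : ∃ k, p ∣ d k
    · obtain ⟨k, hk⟩ := h
      refine ⟨max 1 (1 / padicNorm p (d k : ℚ)), le_max_left _ _, fun n => ?_⟩
      by_cases hnk : n = k
      · subst hnk; exact le_max_right _ _
      · have : ¬ p ∣ d n := fun hn =>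
          Nat.not_coprime_of_dvd_of_dvd hp.one_lt hn hk (hcop n k hnk)
        rw [(padicNorm.nat_eq_one_iff _).mpr this]
        simp
    · refine ⟨1, le_rfl, fun n => ?_⟩
      rw [(padicNorm.nat_eq_one_iff _).mpr (fun hn => h ⟨n, hn⟩)]
      simp
  obtain ⟨B, hB1, hB⟩ := hB
  have key : ∀ x ∈ N, padicNorm p x ≤ B := by
    intro x hx
    rw [hN] at hx
    induction hx using AddSubmonoid.closure_induction with
    | mem x hx =>
      obtain ⟨n, rfl⟩ := hx
      rw [padicNorm.div]
      refine le_trans ?_ (hB n)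
      exact div_le_div_of_nonneg_right (padicNorm.of_nat _) (padicNorm.nonneg _)
    | zero => simp; linarith
    | add x y _ _ hx hy => exact padicNorm.nonarchimedean.trans (max_le hx hy)
  obtain ⟨n, hn⟩ := pow_unbounded_of_one_lt B hq1
  have hpow : ∀ m : ℕ, padicNorm p (q ^ m) = padicNorm p q ^ m := by
    intro m
    induction m with
    | zero => simp
    | succ m ih => rw [pow_succ, padicNorm.mul, ih, pow_succ]
  have h1 := key (q ^ (n + 1)) (hMN (hM ▸ AddSubmonoid.subset_closure ⟨n, rfl⟩))
  rw [hpow] at h1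
  have h2 := pow_le_pow_right₀ hq1.le (Nat.le_succ n)
  exact absurd (hn.trans_le (h2.trans h1)) (lt_irrefl _)
end

section
/- Every almost reciprocal Puiseux monoid has unique atomic decomposition. That is, if (d_n)_{n≥1} is a strictly increasing sequence of pairwise relatively prime positive integers, (c_n)_{n≥1} is a sequence of positive integers with gcd(c_n, d_n) = 1 for every n, and M = ⟨c_n/d_n : n ∈ ℕ⟩, then every element of M can be written in exactly one way as N + Σ_{i} α_i (c_i/d_i) with N a nonnegative integer, α_i ∈ {0, 1, ..., d_i − 1} for every i, and only finitely many α_i nonzero. -/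
lemma aux_dvd (c d : ℕ → ℕ) (hd0 : ∀ n, 0 < d n)
    (hcop : ∀ m n, m ≠ n → Nat.Coprime (d m) (d n))
    (hcd : ∀ n, Nat.Coprime (c n) (d n)) (s : Finset ℕ) (z : ℤ) (a : ℕ → ℤ)
    (h : (z : ℚ) + ∑ i ∈ s, (a i : ℚ) * ((c i : ℚ) / (d i : ℚ)) = 0) (j : ℕ) (hj : j ∈ s) :
    (d j : ℤ) ∣ a j := by
  have hdq : ∀ i, (d i : ℚ) ≠ 0 := fun i => by exact_mod_cast (hd0 i).ne'
  have key : z * ∏ i ∈ s, (d i : ℤ) + ∑ i ∈ s, a i * c i * ∏ k ∈ s.erase i, (d k : ℤ) = 0 := by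
    have h2 : ((z * ∏ i ∈ s, (d i : ℤ) + ∑ i ∈ s, a i * c i * ∏ k ∈ s.erase i, (d k : ℤ) : ℤ) : ℚ)
        = ((z : ℚ) + ∑ i ∈ s, (a i : ℚ) * ((c i : ℚ) / (d i : ℚ))) * ∏ i ∈ s, (d i : ℚ) := by
      push_cast
      rw [add_mul, Finset.sum_mul]
      congr 1
      refine Finset.sum_congr rfl fun i hi => ?_
      rw [← Finset.mul_prod_erase s (fun k => (d k : ℚ)) hi]
      have := hdq i
      field_simp
    rw [h, zero_mul] at h2
    exact_mod_cast h2
  rw [← Finset.add_sum_erase s _ hj] at key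
  have h1 : (d j : ℤ) ∣ z * ∏ i ∈ s, (d i : ℤ) :=
    Dvd.dvd.mul_left (Finset.dvd_prod_of_mem (fun i => (d i : ℤ)) hj) _
  have h2 : (d j : ℤ) ∣ ∑ i ∈ s.erase j, a i * c i * ∏ k ∈ s.erase i, (d k : ℤ) := by
    refine Finset.dvd_sum fun i hi => Dvd.dvd.mul_left ?_ _
    exact Finset.dvd_prod_of_mem (fun i => (d i : ℤ))
      (Finset.mem_erase.2 ⟨(Finset.ne_of_mem_erase hi).symm, hj⟩)
  have h3 : (d j : ℤ) ∣ a j * c j * ∏ k ∈ s.erase j, (d k : ℤ) := by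
    have e : a j * c j * ∏ k ∈ s.erase j, (d k : ℤ) = -(z * ∏ i ∈ s, (d i : ℤ))
      - ∑ i ∈ s.erase j, a i * c i * ∏ k ∈ s.erase i, (d k : ℤ) := by linarith
    rw [e]
    exact dvd_sub (dvd_neg.2 h1) h2
  have h4 : IsCoprime (d j : ℤ) (∏ k ∈ s.erase j, (d k : ℤ)) :=
    IsCoprime.prod_right fun k hk =>
      Nat.isCoprime_iff_coprime.2 (hcop j k (Finset.ne_of_mem_erase hk).symm)
  have h5 : IsCoprime (d j : ℤ) (c j : ℤ) := Nat.isCoprime_iff_coprime.2 (hcd j).symm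
  exact h5.dvd_of_dvd_mul_right (h4.dvd_of_dvd_mul_right h3)

lemma aux_repr (c d : ℕ → ℕ) (x : ℚ)
    (hx : x ∈ AddSubmonoid.closure {q : ℚ | ∃ n, q = (c n : ℚ) / (d n : ℚ)}) :
    ∃ b : ℕ →₀ ℕ, x = b.sum fun i k => (k : ℚ) * ((c i : ℚ) / (d i : ℚ)) := by
  induction hx using AddSubmonoid.closure_induction with
  | mem x h =>
    obtain ⟨n, rfl⟩ := h
    exact ⟨Finsupp.single n 1, by simp⟩
  | zero => exact ⟨0, by simp⟩
  | add x y _ _ hx hy =>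
    obtain ⟨b, rfl⟩ := hx
    obtain ⟨b', rfl⟩ := hy
    refine ⟨b + b', ?_⟩
    rw [Finsupp.sum_add_index']
    · simp
    · intros; push_cast; ring

/-- every almost reciprocal Puiseux monoid has unique atomic
decomposition: every element of `M = ⟨c n / d n⟩` can be written in exactly one way
as `N + Σ α i • (c i / d i)` with `N ∈ ℕ₀`, `α i < d i` for all `i`, and only
finitely many `α i` nonzero. -/
theorem stmt12 (c d : ℕ → ℕ) (hd : StrictMono d) (hd0 : ∀ n, 0 < d n)
    (hcop : ∀ m n, m ≠ n → Nat.Coprime (d m) (d n))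
    (hc : ∀ n, 0 < c n) (hcd : ∀ n, Nat.Coprime (c n) (d n))
    (M : AddSubmonoid ℚ)
    (hM : M = AddSubmonoid.closure {q : ℚ | ∃ n, q = (c n : ℚ) / (d n : ℚ)}) :
    ∀ x ∈ M, ∃! p : ℕ × (ℕ →₀ ℕ),
      (∀ i, p.2 i < d i) ∧
      x = (p.1 : ℚ) + p.2.sum fun i k => (k : ℚ) * ((c i : ℚ) / (d i : ℚ)) := by
  intro x hx
  rw [hM] at hx
  obtain ⟨b, hb⟩ := aux_repr c d x hx
  have hdq : ∀ i, (d i : ℚ) ≠ 0 := fun i => by exact_mod_cast (hd0 i).ne'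
  refine existsUnique_of_exists_of_unique ?_ ?_
  · refine ⟨(∑ i ∈ b.support, b i / d i * c i,
      Finsupp.onFinset b.support (fun i => b i % d i) ?_), ?_, ?_⟩
    · intro i hi
      rw [Finsupp.mem_support_iff]
      intro h0
      simp [h0] at hi
    · intro i
      exact Nat.mod_lt _ (hd0 i)
    · rw [hb, Finsupp.onFinset_sum _ (by simp)]
      simp only [Finsupp.sum]
      push_cast
      rw [← Finset.sum_add_distrib]
      refine Finset.sum_congr rfl fun i _ => ?_
      have h1 : (b i : ℚ) = (d i : ℚ) * ((b i / d i : ℕ) : ℚ) + ((b i % d i : ℕ) : ℚ) := by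
        exact_mod_cast (Nat.div_add_mod (b i) (d i)).symm
      have := hdq i
      rw [h1]
      field_simp
  · rintro ⟨N, f⟩ ⟨N', g⟩ ⟨hf, hfx⟩ ⟨hg, hgx⟩
    simp only at hf hfx hg hgx
    rw [Finsupp.sum_of_support_subset f (Finset.subset_union_left (s₂ := g.support)) _
      (by simp)] at hfx
    rw [Finsupp.sum_of_support_subset g (Finset.subset_union_right (s₁ := f.support)) _
      (by simp)] at hgx
    have hfg : f = g := by
      ext j
      by_cases hj : j ∈ f.support ∪ g.support
      · have := aux_dvd c d hd0 hcop hcd (f.support ∪ g.support) ((N : ℤ) - N')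
          (fun i => (f i : ℤ) - g i) (by
            push_cast
            simp only [sub_mul, Finset.sum_sub_distrib]
            linarith) j hj
        have h1 := hf j
        have h2 := hg j
        have h3 := Int.eq_zero_of_abs_lt_dvd this (by rw [abs_lt]; constructor <;> omega)
        omega
      · simp only [Finset.mem_union, Finsupp.mem_support_iff, not_or, not_not] at hj
        rw [hj.1, hj.2]
    subst hfg
    have : (N : ℚ) = N' := by linarith
    have : N = N' := by exact_mod_cast this
    rw [this]
end

section
/- Let (p_n)_{n≥1} be a strictly increasing sequence of prime numbers and let M be the Puiseux monoid generated by {1/(p_n p_{n+1}) : n ∈ ℕ}. Then M is atomic with 𝒜(M) = {1/(p_n p_{n+1}) : n ∈ ℕ}, but M does not have unique atomic decomposition: for every n ∈ ℕ with n ≥ 2, the element 1/p_n satisfies 1/p_n = p_{n−1}·(1/(p_{n−1} p_n)) = p_{n+1}·(1/(p_n p_{n+1})), giving two distinct atomic decompositions. -/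
/-- for a strictly increasing sequence of primes `(p n)`, the monoid
`M = ⟨1 / (p n * p (n + 1))⟩` is atomic with atoms exactly the generators, but does
not have unique atomic decomposition: for each `n ≥ 1` the element `1 / p n` equals
both `p (n - 1) • a (n - 1)` and `p (n + 1) • a n`, giving two distinct atomic
decompositions. -/
theorem stmt13 (p : ℕ → ℕ) (hmono : StrictMono p) (hp : ∀ n, (p n).Prime)
    (a : ℕ → ℚ) (ha : ∀ n, a n = 1 / ((p n : ℚ) * (p (n + 1) : ℚ)))
    (M : AddSubmonoid ℚ) (hM : M = AddSubmonoid.closure (Set.range a)) :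
    (PMAtomic M ∧ {x : ℚ | PMAtom M x} = Set.range a) ∧
    (∀ n : ℕ, 1 ≤ n →
      1 / (p n : ℚ) = (p (n - 1) : ℚ) * a (n - 1) ∧
      1 / (p n : ℚ) = (p (n + 1) : ℚ) * a n) ∧
    ¬ (∀ x ∈ M, ∃! pr : ℕ × (ℕ →₀ ℕ),
        (∀ i, pr.2 i < (a i).den) ∧
        x = (pr.1 : ℚ) + pr.2.sum fun i k => (k : ℚ) * a i) := by
  have hpos : ∀ n, (0:ℚ) < p n := fun n => by exact_mod_cast (hp n).pos
  have hapos : ∀ n, 0 < a n := fun n => by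
    rw [ha]; have := hpos n; have := hpos (n+1); positivity
  have hden : ∀ n, (a n).den = p n * p (n+1) := fun n => by
    have h : a n = ((p n * p (n+1) : ℕ) : ℚ)⁻¹ := by rw [ha]; push_cast; rw [one_div]
    rw [h, Rat.inv_natCast_den_of_pos (Nat.mul_pos (hp n).pos (hp (n+1)).pos)]
  have hanti : ∀ i n, i ≤ n → a n ≤ a i := fun i n h => by
    rw [ha, ha]
    have h1 := hpos i
    have h2 := hpos (i+1)
    have h3 : (p i : ℚ) ≤ p n := by exact_mod_cast hmono.monotone h
    have h4 : (p (i+1) : ℚ) ≤ p (n+1) := by exact_mod_cast hmono.monotone (by omega)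
    apply one_div_le_one_div_of_le (by positivity)
    gcongr
  have key : ∀ n, ∀ x ∈ M, 0 ≤ x ∧ (x < a n → ¬ p n ∣ x.den) := by
    intro n x hx
    rw [hM] at hx
    induction hx using AddSubmonoid.closure_induction with
    | mem x hx =>
      obtain ⟨i, rfl⟩ := hx
      refine ⟨(hapos i).le, fun hlt hd => ?_⟩
      have hi : n < i := by
        by_contra hc
        exact absurd (hanti i n (by omega)) (not_le.mpr hlt)
      rw [hden, (hp n).dvd_mul, Nat.prime_dvd_prime_iff_eq (hp n) (hp i),
        Nat.prime_dvd_prime_iff_eq (hp n) (hp (i+1))] at hd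
      rcases hd with hd | hd
      · have := hmono.injective hd; omega
      · have := hmono.injective hd; omega
    | zero => exact ⟨le_refl _, fun _ h => (hp n).one_lt.ne' (by simpa using h)⟩
    | add x y _ _ hx hy =>
      refine ⟨add_nonneg hx.1 hy.1, fun hlt hd => ?_⟩
      have := hx.1
      have := hy.1
      rcases (hp n).dvd_mul.mp (hd.trans (Rat.add_den_dvd x y)) with h | h
      · exact hx.2 (by linarith) h
      · exact hy.2 (by linarith) h
  have hmem : ∀ n, a n ∈ M := fun n => by
    rw [hM]; exact AddSubmonoid.subset_closure ⟨n, rfl⟩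
  have hatom : ∀ n, PMAtom M (a n) := by
    intro n
    refine ⟨hmem n, (hapos n).ne', fun q r hq hr h => ?_⟩
    by_contra! hc
    have hq0 := lt_of_le_of_ne (key n q hq).1 hc.1.symm
    have hr0 := lt_of_le_of_ne (key n r hr).1 hc.2.symm
    have hd : p n ∣ (q + r).den := by rw [← h, hden]; exact dvd_mul_right _ _
    rcases (hp n).dvd_mul.mp (hd.trans (Rat.add_den_dvd q r)) with h' | h'
    · exact (key n q hq).2 (by linarith) h'
    · exact (key n r hr).2 (by linarith) h'
  have hfac : ∀ x ∈ M, ∃ s : Multiset ℚ, (∀ b ∈ s, b ∈ Set.range a) ∧ s.sum = x := by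
    intro x hx
    rw [hM] at hx
    exact AddSubmonoid.exists_multiset_of_mem_closure hx
  have hrec : ∀ n : ℕ, 1 ≤ n →
      1 / (p n : ℚ) = (p (n - 1) : ℚ) * a (n - 1) ∧
      1 / (p n : ℚ) = (p (n + 1) : ℚ) * a n := by
    intro n hn
    obtain ⟨m, rfl⟩ : ∃ m, n = m + 1 := ⟨n - 1, by omega⟩
    have h1 := (hpos m).ne'
    have h2 := (hpos (m+1)).ne'
    have h3 := (hpos (m+1+1)).ne'
    rw [Nat.add_sub_cancel, ha, ha]
    constructor <;> field_simp
  refine ⟨⟨?_, ?_⟩, hrec, ?_⟩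
  · intro x hx _
    obtain ⟨s, hs, hsum⟩ := hfac x hx
    refine ⟨s, fun b hb => ?_, hsum⟩
    obtain ⟨i, rfl⟩ := hs b hb
    exact hatom i
  · ext x
    constructor
    · rintro ⟨hx, hx0, hat⟩
      obtain ⟨s, hs, hsum⟩ := hfac x hx
      induction s using Multiset.induction_on with
      | empty => exact absurd (by simpa using hsum.symm) hx0
      | cons b t _ =>
        obtain ⟨i, hi⟩ := hs b (Multiset.mem_cons_self b t)
        rw [Multiset.sum_cons] at hsum
        have ht : t.sum ∈ M := AddSubmonoid.multiset_sum_mem _ _ fun c hc => by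
          obtain ⟨j, rfl⟩ := hs c (Multiset.mem_cons_of_mem hc)
          exact hmem j
        rcases hat b t.sum (hi ▸ hmem i) ht hsum.symm with h | h
        · exact absurd (hi.trans h) (hapos i).ne'
        · exact ⟨i, by rw [hi, ← hsum, h, add_zero]⟩
    · rintro ⟨i, rfl⟩
      exact hatom i
  · intro H
    obtain ⟨h1, h2⟩ := hrec 1 le_rfl
    have hxM : 1 / (p 1 : ℚ) ∈ M := by
      rw [h2, ← nsmul_eq_mul]; exact AddSubmonoid.nsmul_mem _ (hmem 1) _
    have hbd : ∀ j k, k < (a j).den → ∀ i, (Finsupp.single j k) i < (a i).den := by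
      intro j k hk i
      rw [Finsupp.single_apply]
      split_ifs with h
      · exact h ▸ hk
      · exact (a i).den_pos
    have e := (H _ hxM).unique (y₁ := (0, Finsupp.single 0 (p 0)))
      (y₂ := (0, Finsupp.single 1 (p 2)))
      ⟨hbd 0 _ (by rw [hden]; exact lt_mul_of_one_lt_right (hp 0).pos (hp _).one_lt),
        by rw [h1]; simp⟩
      ⟨hbd 1 _ (by rw [hden]; exact lt_mul_of_one_lt_left (hp 2).pos (hp _).one_lt),
        by rw [h2]; simp⟩
    have e2 := DFunLike.congr_fun (Prod.mk.inj e).2 0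
    simp at e2
    exact (hp 0).ne_zero e2
end

section
/- Every almost reciprocal Puiseux monoid satisfies the ascending chain condition on principal ideals (ACCP). -/
theorem ar_clear (c d : ℕ → ℕ) (hd : ∀ n, 0 < d n) (e : ℕ → ℤ) (s : Finset ℕ) :
    ∃ t : ℤ, ((∏ i ∈ s, d i : ℕ) : ℚ) * ∑ i ∈ s, (e i : ℚ) * ((c i : ℚ) / (d i : ℚ)) = t := by
  classical
  induction s using Finset.induction_on with
  | empty => exact ⟨0, by simp⟩
  | insert a s ha ih =>
    obtain ⟨t, ht⟩ := ih
    refine ⟨(∏ i ∈ s, d i : ℕ) * (e a * c a) + d a * t, ?_⟩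
    rw [Finset.prod_insert ha, Finset.sum_insert ha]
    have h0 : (d a : ℚ) ≠ 0 := by exact_mod_cast (hd a).ne'
    push_cast at ht ⊢
    rw [← ht]
    field_simp

theorem ar_dvd (c d : ℕ → ℕ) (hd : ∀ n, 0 < d n)
    (hdd : ∀ m n, m ≠ n → Nat.Coprime (d m) (d n)) (hcd : ∀ n, Nat.Coprime (c n) (d n))
    (e : ℕ → ℤ) (s : Finset ℕ) (k : ℤ)
    (h : (k : ℚ) + ∑ i ∈ s, (e i : ℚ) * ((c i : ℚ) / (d i : ℚ)) = 0) (n : ℕ) (hn : n ∈ s) :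
    (d n : ℤ) ∣ e n := by
  classical
  obtain ⟨t, ht⟩ := ar_clear c d hd e (s.erase n)
  rw [← Finset.add_sum_erase s _ hn] at h
  set P := ∏ i ∈ s.erase n, d i with hP
  have h0 : (d n : ℚ) ≠ 0 := by exact_mod_cast (hd n).ne'
  have hq : (e n : ℚ) * (c n * P) = d n * (-(P * k + t)) := by
    rw [← ht]
    have : (e n : ℚ) * (c n * P) = d n * (P * (e n * (c n / d n))) := by field_simp
    rw [this]
    congr 1
    linear_combination (P : ℚ) * h
  have hz : e n * ((c n * P : ℕ) : ℤ) = d n * (-(P * k + t)) := by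
    push_cast
    exact_mod_cast hq
  have hcop : Nat.Coprime (d n) (c n * P) := by
    refine Nat.Coprime.mul_right (hcd n).symm ?_
    refine Nat.Coprime.prod_right fun i hi => hdd _ _ ?_
    exact (Finset.ne_of_mem_erase hi).symm
  exact (Nat.isCoprime_iff_coprime.2 hcop).dvd_of_dvd_mul_right
    (Dvd.intro _ hz.symm)

/-- value of a representation -/
def arVal (c d : ℕ → ℕ) (k : ℕ) (a : ℕ →₀ ℕ) : ℚ :=
  (k : ℚ) + a.sum fun n m => (m : ℚ) * ((c n : ℚ) / (d n : ℚ))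

theorem arVal_eq (c d : ℕ → ℕ) (k : ℕ) (a : ℕ →₀ ℕ) (s : Finset ℕ) (hs : a.support ⊆ s) :
    arVal c d k a = (k : ℚ) + ∑ n ∈ s, (a n : ℚ) * ((c n : ℚ) / (d n : ℚ)) := by
  unfold arVal
  rw [Finsupp.sum_of_support_subset a hs _ (by simp)]

theorem arVal_add (c d : ℕ → ℕ) (k l : ℕ) (a b : ℕ →₀ ℕ) :
    arVal c d (k + l) (a + b) = arVal c d k a + arVal c d l b := by
  unfold arVal
  rw [Finsupp.sum_add_index' (by simp) (by intros; push_cast; ring)]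
  push_cast; ring

theorem ar_unique (c d : ℕ → ℕ) (hd : ∀ n, 0 < d n)
    (hdd : ∀ m n, m ≠ n → Nat.Coprime (d m) (d n)) (hcd : ∀ n, Nat.Coprime (c n) (d n))
    (k l : ℕ) (a b : ℕ →₀ ℕ) (ha : ∀ n, a n < d n) (hb : ∀ n, b n < d n)
    (h : arVal c d k a = arVal c d l b) : k = l ∧ a = b := by
  classical
  have h' := h
  rw [arVal_eq c d k a (a.support ∪ b.support) Finset.subset_union_left,
    arVal_eq c d l b (a.support ∪ b.support) Finset.subset_union_right] at h
  have hab : a = b := by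
    ext n
    by_cases hn : n ∈ a.support ∪ b.support
    · have := ar_dvd c d hd hdd hcd (fun i => (a i : ℤ) - b i) (a.support ∪ b.support)
        ((k : ℤ) - l) (by
          push_cast
          simp only [sub_mul, Finset.sum_sub_distrib]
          linarith) n hn
      have h1 := ha n
      have h2 := hb n
      have := Int.eq_zero_of_abs_lt_dvd this (by rw [abs_lt]; constructor <;> omega)
      omega
    · simp at hn
      omega
  subst hab
  refine ⟨?_, rfl⟩
  have := add_right_cancel h
  exact_mod_cast this

theorem ar_normal (c d : ℕ → ℕ) (hd : ∀ n, 0 < d n) (hc : ∀ n, 0 < c n)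
    (k : ℕ) (a : ℕ →₀ ℕ) : ∃ (l : ℕ) (b : ℕ →₀ ℕ), (∀ n, b n < d n) ∧
      arVal c d l b = arVal c d k a ∧ (k < l ∨ (k = l ∧ a = b)) := by
  classical
  let b : ℕ →₀ ℕ := Finsupp.onFinset a.support (fun n => a n % d n) (by
    intro n hn
    rw [Finsupp.mem_support_iff]
    intro h0
    simp [h0] at hn)
  have hb : ∀ n, b n = a n % d n := fun n => rfl
  have hsupp : b.support ⊆ a.support := Finsupp.support_onFinset_subset
  refine ⟨k + ∑ n ∈ a.support, (a n / d n) * c n, b,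
    fun n => by rw [hb]; exact Nat.mod_lt _ (hd n), ?_, ?_⟩
  · rw [arVal_eq c d _ b a.support hsupp, arVal_eq c d k a a.support subset_rfl]
    push_cast
    rw [add_assoc, ← Finset.sum_add_distrib]
    congr 1
    refine Finset.sum_congr rfl fun n _ => ?_
    have h0 : (d n : ℚ) ≠ 0 := by exact_mod_cast (hd n).ne'
    have h1 : ((d n * (a n / d n) + a n % d n : ℕ) : ℚ) = a n := by rw [Nat.div_add_mod]
    rw [hb, ← h1]
    push_cast
    field_simp
  · rcases Nat.eq_zero_or_pos (∑ n ∈ a.support, (a n / d n) * c n) with h | h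
    · right
      refine ⟨by omega, ?_⟩
      ext n
      rw [hb]
      by_cases hn : n ∈ a.support
      · have h2 := (Finset.sum_eq_zero_iff.1 h) n hn
        have h3 : a n / d n = 0 := (Nat.mul_eq_zero.1 h2).resolve_right (hc n).ne'
        have h4 := Nat.div_add_mod (a n) (d n)
        rw [h3] at h4
        omega
      · rw [Finsupp.notMem_support_iff.1 hn]; simp
    · left; omega

theorem ar_exists (c d : ℕ → ℕ) (x : ℚ)
    (hx : x ∈ AddSubmonoid.closure {q : ℚ | ∃ n, q = (c n : ℚ) / (d n : ℚ)}) :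
    ∃ a : ℕ →₀ ℕ, x = arVal c d 0 a := by
  induction hx using AddSubmonoid.closure_induction with
  | mem x hx =>
    obtain ⟨n, rfl⟩ := hx
    exact ⟨Finsupp.single n 1, by simp [arVal]⟩
  | zero => exact ⟨0, by simp [arVal]⟩
  | add x y _ _ hx hy =>
    obtain ⟨a, rfl⟩ := hx
    obtain ⟨b, rfl⟩ := hy
    exact ⟨a + b, by rw [← arVal_add]⟩

/-- every almost reciprocal Puiseux monoid satisfies the ACCP. -/
theorem stmt14 (M : AddSubmonoid ℚ) (hM : AlmostReciprocal M) : SatisfiesACCP M := by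
  obtain ⟨c, d, -, hd, hdd, hc, hcd, hMeq⟩ := hM
  have hnf : ∀ x ∈ M, ∃ (k : ℕ) (a : ℕ →₀ ℕ), (∀ n, a n < d n) ∧ arVal c d k a = x := by
    intro x hx
    rw [hMeq] at hx
    obtain ⟨a, rfl⟩ := ar_exists c d x hx
    obtain ⟨l, b, h1, h2, -⟩ := ar_normal c d hd hc 0 a
    exact ⟨l, b, h1, h2⟩
  intro q hq hsub
  have hstep : ∀ n, ∃ m ∈ M, q n = q (n + 1) + m := fun n =>
    hsub n ⟨0, M.zero_mem, by simp⟩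
  choose k a ha hv using fun n => hnf (q n) (hq n)
  let f : ℕ → ℕ ×ₗ ℕ := fun n => toLex (k n, (a n).degree)
  have hf : ∀ n, q n = q (n + 1) ∨ f (n + 1) < f n := by
    intro n
    obtain ⟨m, hm, hqm⟩ := hstep n
    obtain ⟨l, b, hb, hbm⟩ := hnf m hm
    obtain ⟨l', b', hb', hbv, hor⟩ := ar_normal c d hd hc (k (n + 1) + l) (a (n + 1) + b)
    rw [arVal_add, hv, hbm, ← hqm, ← hv n] at hbv
    obtain ⟨rfl, rfl⟩ := ar_unique c d hd hdd hcd _ _ _ _ hb' (ha n) hbv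
    rcases hor with hlt | ⟨h1, h2⟩
    · right
      simp only [f, Prod.Lex.toLex_lt_toLex]
      left; omega
    · by_cases hl : l = 0
      · by_cases hb0 : b = 0
        · left
          rw [hqm, ← hbm, hl, hb0]
          simp [arVal]
        · right
          simp only [f, Prod.Lex.toLex_lt_toLex]
          right
          refine ⟨by omega, ?_⟩
          rw [← h2, map_add]
          have : b.degree ≠ 0 := by rwa [Ne, Finsupp.degree_eq_zero_iff]
          omega
      · right
        simp only [f, Prod.Lex.toLex_lt_toLex]
        left; omega
  obtain ⟨_, ⟨N, rfl⟩, hmin⟩ := (wellFounded_lt (α := ℕ ×ₗ ℕ)).has_min (Set.range f) ⟨_, 0, rfl⟩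
  refine ⟨N, ?_⟩
  have key : ∀ n, N ≤ n → q n = q N ∧ f n = f N := by
    intro n hn
    induction n, hn using Nat.le_induction with
    | base => exact ⟨rfl, rfl⟩
    | succ n hn ih =>
      rcases hf n with h | h
      · have h2 : q (n + 1) = q n := h.symm
        obtain ⟨h3, h4⟩ := ar_unique c d hd hdd hcd _ _ _ _ (ha (n + 1)) (ha n)
          (by rw [hv, hv, h2])
        refine ⟨h2.trans ih.1, ?_⟩
        rw [← ih.2]
        simp only [f, h3, h4]
      · rw [ih.2] at h
        exact absurd h (hmin _ ⟨_, rfl⟩)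
  intro n hn
  rw [(key n hn).1]
end

section
/- Let (p_n)_{n≥1} be a strictly increasing sequence of prime numbers and let ℓ be a positive integer. Then the Puiseux monoid M generated by {1/(p_n p_{n+ℓ}) : n ∈ ℕ} is atomic but does not satisfy the ascending chain condition on principal ideals: the chain of principal ideals (1/p_{ℓn} + M)_{n≥1} is strictly ascending and does not stabilize. -/
def gg (p : ℕ → ℕ) (l n : ℕ) : ℚ := 1 / ((p n : ℚ) * (p (n + l) : ℚ))

lemma gg_pos (p : ℕ → ℕ) (hp : ∀ n, (p n).Prime) (l n : ℕ) : 0 < gg p l n := by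
  have h1 : (0:ℚ) < p n := by exact_mod_cast (hp n).pos
  have h2 : (0:ℚ) < p (n+l) := by exact_mod_cast (hp (n+l)).pos
  unfold gg; positivity

lemma gg_anti (p : ℕ → ℕ) (hmono : StrictMono p) (hp : ∀ n, (p n).Prime) (l : ℕ) {m n : ℕ}
    (h : m ≤ n) : gg p l n ≤ gg p l m := by
  have h1 : (0:ℚ) < p m := by exact_mod_cast (hp m).pos
  have h2 : (0:ℚ) < p (m+l) := by exact_mod_cast (hp (m+l)).pos
  have h3 : (p m : ℚ) ≤ p n := by exact_mod_cast hmono.monotone h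
  have h4 : (p (m+l) : ℚ) ≤ p (n+l) := by exact_mod_cast hmono.monotone (by omega)
  unfold gg
  gcongr

lemma gg_dvd (p : ℕ → ℕ) (l n N q : ℕ) (hq : q.Prime) (hp : ∀ n, (p n).Prime) (c : ℕ → ℕ)
    (h : ∑ i ∈ Finset.range (N+1), (c i : ℚ) * gg p l i = gg p l n)
    (h1 : ∀ i < N, ¬ q ∣ p i * p (i+l)) (h2 : ¬ q ∣ p n * p (n+l))
    (h3 : q ∣ p N * p (N+l)) : q ∣ c N := by
  have := Fact.mk hq
  have key : ∀ i, ¬ q ∣ p i * p (i+l) → padicNorm q (gg p l i) = 1 := by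
    intro i hi
    have := (padicNorm.nat_eq_one_iff (p := q) (p i * p (i+l))).2 hi
    unfold gg
    rw [padicNorm.div, padicNorm.one]
    push_cast at this
    rw [this]; norm_num
  rw [Finset.sum_range_succ] at h
  have h4 : (c N : ℚ) * gg p l N = gg p l n - ∑ i ∈ Finset.range N, (c i : ℚ) * gg p l i := by
    linarith
  have h5 : padicNorm q (∑ i ∈ Finset.range N, (c i : ℚ) * gg p l i) ≤ 1 := by
    apply padicNorm.sum_le' _ zero_le_one
    intro i hi
    rw [padicNorm.mul, key i (h1 i (Finset.mem_range.1 hi)), mul_one]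
    exact_mod_cast padicNorm.of_nat (p := q) (c i)
  have h6 : padicNorm q ((c N : ℚ) * gg p l N) ≤ 1 := by
    rw [h4]
    exact padicNorm.sub.trans (max_le (key n h2).le h5)
  have h7 := (padicNorm.nat_lt_one_iff (p := q) (p N * p (N+l))).2 h3
  rw [← padicNorm.nat_lt_one_iff (p := q)]
  have h8 : (c N : ℚ) = (c N : ℚ) * gg p l N * ((p N * p (N+l) : ℕ) : ℚ) := by
    have e1 : (p N : ℚ) ≠ 0 := by exact_mod_cast (hp N).ne_zero
    have e2 : (p (N+l) : ℚ) ≠ 0 := by exact_mod_cast (hp (N+l)).ne_zero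
    unfold gg; push_cast; field_simp
  rw [h8, padicNorm.mul]
  calc _ ≤ 1 * padicNorm q ((p N * p (N+l) : ℕ) : ℚ) := by
        gcongr
        exact padicNorm.nonneg _
    _ < 1 := by rw [one_mul]; exact h7

lemma ndvd_aux (p : ℕ → ℕ) (hmono : StrictMono p) (hp : ∀ n, (p n).Prime) (l i j : ℕ)
    (h1 : j ≠ i) (h2 : j ≠ i + l) : ¬ p j ∣ p i * p (i+l) := by
  intro h
  rcases (hp j).dvd_mul.1 h with h | h
  · exact h1 (hmono.injective ((Nat.prime_dvd_prime_iff_eq (hp _) (hp _)).1 h))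
  · exact h2 (hmono.injective ((Nat.prime_dvd_prime_iff_eq (hp _) (hp _)).1 h))

lemma main_aux (p : ℕ → ℕ) (hmono : StrictMono p) (hp : ∀ n, (p n).Prime) (l : ℕ) (hl : 0 < l)
    (n N : ℕ) : ∀ c : ℕ → ℕ, ∑ i ∈ Finset.range N, (c i : ℚ) * gg p l i = gg p l n →
      ∑ i ∈ Finset.range N, c i ≤ 1 := by
  have base : ∀ N ≤ n + 1, ∀ c : ℕ → ℕ,
      ∑ i ∈ Finset.range N, (c i : ℚ) * gg p l i = gg p l n →
      ∑ i ∈ Finset.range N, c i ≤ 1 := by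
    intro N hN c h
    have h1 : (∑ i ∈ Finset.range N, (c i : ℚ)) * gg p l n ≤ 1 * gg p l n := by
      rw [one_mul]
      conv_rhs => rw [← h]
      rw [Finset.sum_mul]
      apply Finset.sum_le_sum
      intro i hi
      have := Finset.mem_range.1 hi
      have := gg_anti p hmono hp l (show i ≤ n by omega)
      gcongr
    have := le_of_mul_le_mul_right h1 (gg_pos p hp l n)
    exact_mod_cast this
  induction N with
  | zero => intro c _; simp
  | succ N ih =>
    rcases Nat.lt_or_ge n N with hN | hN
    swap
    · exact base _ (by omega)
    intro c h
    by_cases h0 : c N = 0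
    · rw [Finset.sum_range_succ, h0] at h ⊢
      exact ih c (by simpa using h)
    exfalso
    have hP1 : (p N : ℚ) ≠ 0 := by exact_mod_cast (hp N).ne_zero
    have hP2 : (p (N+l) : ℚ) ≠ 0 := by exact_mod_cast (hp (N+l)).ne_zero
    have d1 : p (N+l) ∣ c N := gg_dvd p l n N _ (hp _) hp c h
      (fun i hi => ndvd_aux p hmono hp l i _ (by omega) (by omega))
      (ndvd_aux p hmono hp l n _ (by omega) (by omega)) (dvd_mul_left _ _)
    rcases Nat.lt_or_ge N l with hNl | hNl
    · have d2 : p N ∣ c N := gg_dvd p l n N _ (hp _) hp c h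
        (fun i hi => ndvd_aux p hmono hp l i _ (by omega) (by omega))
        (ndvd_aux p hmono hp l n _ (by omega) (by omega)) (dvd_mul_right _ _)
      have hne : p N ≠ p (N+l) := fun e => by have := hmono.injective e; omega
      have d3 : p N * p (N+l) ∣ c N :=
        Nat.Coprime.mul_dvd_of_dvd_of_dvd ((Nat.coprime_primes (hp _) (hp _)).2 hne) d2 d1
      obtain ⟨k, hk⟩ := d3
      have hk1 : 1 ≤ k := Nat.one_le_iff_ne_zero.2 (by rintro rfl; simp at hk; exact h0 hk)
      have e : (c N : ℚ) * gg p l N = k := by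
        rw [hk]; unfold gg; push_cast; field_simp
      have hk2 : (1:ℚ) ≤ k := by exact_mod_cast hk1
      rw [Finset.sum_range_succ, e] at h
      have hs : 0 ≤ ∑ i ∈ Finset.range N, (c i : ℚ) * gg p l i :=
        Finset.sum_nonneg fun i _ => mul_nonneg (by positivity) (gg_pos p hp l i).le
      have g1 : gg p l n < 1 := by
        have a1 : (1:ℚ) < p n := by exact_mod_cast (hp n).one_lt
        have a2 : (1:ℚ) < p (n+l) := by exact_mod_cast (hp (n+l)).one_lt
        unfold gg
        rw [div_lt_one (by positivity)]
        nlinarith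
      linarith
    · obtain ⟨k, hk⟩ := d1
      have hk1 : 1 ≤ k := Nat.one_le_iff_ne_zero.2 (by rintro rfl; simp at hk; exact h0 hk)
      obtain ⟨m, rfl⟩ : ∃ m, N = m + l := ⟨N - l, by omega⟩
      have hm : m ∈ Finset.range (m + l) := Finset.mem_range.2 (by omega)
      have hP3 : (p m : ℚ) ≠ 0 := by exact_mod_cast (hp m).ne_zero
      have e : (c (m+l) : ℚ) * gg p l (m+l) = ((k * p m : ℕ) : ℚ) * gg p l m := by
        rw [hk]; unfold gg; push_cast; field_simp
      rw [Finset.sum_range_succ, e] at h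
      have := ih (fun i => c i + if i = m then k * p m else 0) (by
        rw [← h]
        push_cast
        simp only [add_mul, Finset.sum_add_distrib, ite_mul, zero_mul]
        rw [Finset.sum_ite_eq' _ m, if_pos hm])
      rw [Finset.sum_add_distrib, Finset.sum_ite_eq', if_pos hm] at this
      have h2 := (hp m).two_le
      have h3 : 1 * 2 ≤ k * p m := Nat.mul_le_mul hk1 h2
      omega

lemma mem_repr (p : ℕ → ℕ) (l : ℕ) (x : ℚ)
    (hx : x ∈ AddSubmonoid.closure {q : ℚ | ∃ n, q = 1 / ((p n : ℚ) * (p (n + l) : ℚ))}) :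
    ∃ (N : ℕ) (c : ℕ → ℕ), ∀ N' ≥ N, x = ∑ i ∈ Finset.range N', (c i : ℚ) * gg p l i := by
  induction hx using AddSubmonoid.closure_induction with
  | mem x hx =>
    obtain ⟨n, rfl⟩ := hx
    refine ⟨n+1, fun i => if i = n then 1 else 0, fun N' hN => ?_⟩
    push_cast
    simp only [ite_mul, zero_mul, one_mul]
    rw [Finset.sum_ite_eq', if_pos (Finset.mem_range.2 (by omega))]
    rfl
  | zero => exact ⟨0, 0, fun _ _ => by simp⟩
  | add x y _ _ hx hy =>
    obtain ⟨N, c, h⟩ := hx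
    obtain ⟨K, d, h'⟩ := hy
    refine ⟨max N K, fun i => c i + d i, fun N' hN => ?_⟩
    rw [h N' (le_trans (le_max_left _ _) hN), h' N' (le_trans (le_max_right _ _) hN)]
    push_cast
    simp only [add_mul, Finset.sum_add_distrib]


/-- for a strictly increasing sequence of primes `(p n)` and `ℓ ≥ 1`,
the monoid `M = ⟨1 / (p n * p (n + ℓ))⟩` is atomic but does not satisfy the ACCP:
the chain of principal ideals generated by the elements `1 / p_{ℓ n}` (here, in
0-indexed form, `1 / p (ℓ * n + ℓ - 1)`) is strictly ascending. -/
theorem stmt15 (p : ℕ → ℕ) (hmono : StrictMono p) (hp : ∀ n, (p n).Prime)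
    (ℓ : ℕ) (hℓ : 0 < ℓ) (M : AddSubmonoid ℚ)
    (hM : M = AddSubmonoid.closure
      {q : ℚ | ∃ n, q = 1 / ((p n : ℚ) * (p (n + ℓ) : ℚ))}) :
    PMAtomic M ∧
    (∀ n : ℕ, 1 / (p (ℓ * n + ℓ - 1) : ℚ) ∈ M) ∧
    (∀ n : ℕ, PrincipalIdeal M (1 / (p (ℓ * n + ℓ - 1) : ℚ)) ⊂
      PrincipalIdeal M (1 / (p (ℓ * (n + 1) + ℓ - 1) : ℚ))) ∧
    ¬ SatisfiesACCP M := by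
  have hgen : ∀ n, gg p ℓ n ∈ M := fun n => by
    rw [hM]; exact AddSubmonoid.subset_closure ⟨n, rfl⟩
  have hnn : ∀ x ∈ M, 0 ≤ x := by
    intro x hx
    rw [hM] at hx
    obtain ⟨N, c, h⟩ := mem_repr p ℓ x hx
    rw [h N le_rfl]
    exact Finset.sum_nonneg fun i _ => mul_nonneg (by positivity) (gg_pos p hp ℓ i).le
  have hatom : ∀ n, PMAtom M (gg p ℓ n) := by
    intro n
    refine ⟨hgen n, (gg_pos p hp ℓ n).ne', ?_⟩
    intro q r hq hr h
    rw [hM] at hq hr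
    obtain ⟨N, c, hc⟩ := mem_repr p ℓ q hq
    obtain ⟨K, d, hd⟩ := mem_repr p ℓ r hr
    have hc := hc (max N K) (le_max_left _ _)
    have hd := hd (max N K) (le_max_right _ _)
    have := main_aux p hmono hp ℓ hℓ n (max N K) (fun i => c i + d i) (by
      rw [h, hc, hd]
      push_cast
      simp only [add_mul, Finset.sum_add_distrib])
    rw [Finset.sum_add_distrib] at this
    have h0 : ∑ i ∈ Finset.range (max N K), c i = 0 ∨ ∑ i ∈ Finset.range (max N K), d i = 0 := by
      omega
    rcases h0 with h0 | h0
    · left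
      rw [hc]
      refine Finset.sum_eq_zero fun i hi => ?_
      rw [Finset.sum_eq_zero_iff.1 h0 i hi]; simp
    · right
      rw [hd]
      refine Finset.sum_eq_zero fun i hi => ?_
      rw [Finset.sum_eq_zero_iff.1 h0 i hi]; simp
  have hat : PMAtomic M := by
    intro x hx _
    rw [hM] at hx
    obtain ⟨s, hs, hsum⟩ := AddSubmonoid.exists_multiset_of_mem_closure hx
    refine ⟨s, fun a ha => ?_, hsum⟩
    obtain ⟨n, rfl⟩ := hs a ha
    exact hatom n
  have hpos : ∀ n, (0:ℚ) < p n := fun n => by exact_mod_cast (hp n).pos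
  have hmem : ∀ k, 1 / (p k : ℚ) ∈ M := by
    intro k
    have := M.nsmul_mem (hgen k) (p (k+ℓ))
    convert this using 1
    have h1 := (hpos k).ne'
    have h2 := (hpos (k+ℓ)).ne'
    unfold gg
    rw [nsmul_eq_mul]
    field_simp
  have hstep : ∀ k, PrincipalIdeal M (1 / (p k : ℚ)) ⊂ PrincipalIdeal M (1 / (p (k+ℓ) : ℚ)) := by
    intro k
    have hlt : p k < p (k+ℓ) := hmono (by omega)
    have h1 := (hpos k).ne'
    have h2 := (hpos (k+ℓ)).ne'
    refine ⟨?_, fun hsub => ?_⟩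
    · rintro x ⟨m, hm, rfl⟩
      refine ⟨(p (k+ℓ) - p k) • gg p ℓ k + m, M.add_mem (M.nsmul_mem (hgen k) _) hm, ?_⟩
      unfold gg
      rw [nsmul_eq_mul, Nat.cast_sub hlt.le]
      field_simp
      ring
    · obtain ⟨m, hm, h⟩ := hsub ⟨0, M.zero_mem, (add_zero _).symm⟩
      have := hnn m hm
      have h3 : 1 / (p (k+ℓ) : ℚ) < 1 / (p k : ℚ) :=
        one_div_lt_one_div_of_lt (hpos k) (by exact_mod_cast hlt)
      linarith
  have hchain : ∀ n : ℕ, PrincipalIdeal M (1 / (p (ℓ * n + ℓ - 1) : ℚ)) ⊂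
      PrincipalIdeal M (1 / (p (ℓ * (n + 1) + ℓ - 1) : ℚ)) := by
    intro n
    have e : ℓ * (n + 1) + ℓ - 1 = ℓ * n + ℓ - 1 + ℓ := by
      rw [mul_add, mul_one]; omega
    rw [e]
    exact hstep _
  refine ⟨hat, fun n => hmem _, hchain, fun hA => ?_⟩
  obtain ⟨N, hN⟩ := hA (fun n => 1 / (p (ℓ * n + ℓ - 1) : ℚ)) (fun n => hmem _)
    (fun n => (hchain n).subset)
  exact (hchain N).ne (hN (N+1) (by omega)).symm
end

section
/- Let M be an atomic weak reciprocal Puiseux monoid. Then the set of lengths L_M(1) of the element 1 in M is infinite; in particular, M is not a bounded factorization monoid (BFM). -/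
/-- if `M` is an atomic weak reciprocal Puiseux monoid, then the set
of lengths of `1` in `M` is infinite; in particular `M` is not a BFM. -/
theorem stmt16 (M : AddSubmonoid ℚ) (hM : WeakReciprocal M) (hA : PMAtomic M) :
    (LengthSet M 1).Infinite ∧
    ¬ (PMAtomic M ∧ ∀ x ∈ M, x ≠ 0 → (LengthSet M x).Finite) := by
  obtain ⟨d, hd, hpos, hMe⟩ := hM
  have hgen : ∀ n, (1 / (d n : ℚ)) ∈ M := by
    intro n
    rw [hMe]
    exact AddSubmonoid.subset_closure ⟨n, rfl⟩
  have hq : ∀ n, (0 : ℚ) < d n := fun n => by exact_mod_cast hpos n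
  have hnn : ∀ x ∈ M, 0 ≤ x := by
    intro x hx
    rw [hMe] at hx
    induction hx using AddSubmonoid.closure_induction with
    | mem x hx =>
      obtain ⟨n, rfl⟩ := hx
      exact (one_div_pos.mpr (hq n)).le
    | zero => exact le_rfl
    | add x y _ _ hx hy => exact add_nonneg hx hy
  have hatom : ∀ a, PMAtom M a → ∃ n, a = 1 / (d n : ℚ) := by
    rintro a ⟨ha, ha0, hsplit⟩
    have ha' := ha
    rw [hMe] at ha'
    obtain ⟨l, hl, hsum⟩ := AddSubmonoid.exists_multiset_of_mem_closure ha'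
    induction l using Multiset.induction_on with
    | empty => exact absurd hsum.symm (by simpa using ha0)
    | cons s t _ =>
      obtain ⟨n, hn⟩ := hl s (Multiset.mem_cons_self s t)
      have ht : t.sum ∈ M := by
        apply AddSubmonoid.multiset_sum_mem
        intro y hy
        obtain ⟨k, hk⟩ := hl y (Multiset.mem_cons_of_mem hy)
        rw [hk]
        exact hgen k
      rw [Multiset.sum_cons] at hsum
      rcases hsplit s t.sum (hn ▸ hgen n) ht hsum.symm with h | h
      · have := one_div_pos.mpr (hq n)
        rw [← hn, h] at this
        exact absurd this (lt_irrefl _)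
      · exact ⟨n, by rw [← hsum, h, add_zero, hn]⟩
  have hinf : (LengthSet M 1).Infinite := by
    apply Set.infinite_of_forall_exists_gt
    intro N
    have hN : N < d (N + 1) := lt_of_lt_of_le (Nat.lt_succ_self N) (hd.id_le (N + 1))
    have hp := one_div_pos.mpr (hq (N + 1))
    obtain ⟨s, hs, hsum⟩ := hA _ (hgen (N + 1)) hp.ne'
    have hne : s ≠ 0 := by
      rintro rfl
      rw [← hsum] at hp
      simp at hp
    obtain ⟨a, has⟩ := Multiset.exists_mem_of_ne_zero hne
    have hle : a ≤ s.sum :=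
      Multiset.single_le_sum (fun x hx => hnn x (hs x hx).1) a has
    obtain ⟨m, hm⟩ := hatom a (hs a has)
    rw [hsum, hm, one_div_le_one_div (hq m) (hq (N + 1))] at hle
    have hle' : d (N + 1) ≤ d m := by exact_mod_cast hle
    refine ⟨d m, ⟨Multiset.replicate (d m) a, ?_, ?_, Multiset.card_replicate _ _⟩,
      lt_of_lt_of_le hN hle'⟩
    · intro b hb
      rw [Multiset.eq_of_mem_replicate hb]
      exact hs a has
    · rw [Multiset.sum_replicate, nsmul_eq_mul, hm, mul_one_div_cancel (hq m).ne']
  refine ⟨hinf, fun h => hinf (h.2 1 ?_ one_ne_zero)⟩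
  have := M.nsmul_mem (hgen 0) (d 0)
  rwa [nsmul_eq_mul, mul_one_div_cancel (hq 0).ne'] at this
end

section
/- Let M be an atomic reciprocal Puiseux monoid and let q be a nonzero element of M. If 1 divides q in M (i.e., q = 1 + q' for some q' ∈ M), then the set of lengths L_M(q) is infinite; if 1 does not divide q in M, then q has exactly one factorization in M, so |L_M(q)| = 1. In particular, |L_M(q)| ∈ {1, ∞} for every nonzero q ∈ M. -/
theorem aux_sum (d : ℕ → ℕ) (hpos : ∀ n, 0 < d n)
    (hc : ∀ m n, m ≠ n → Nat.Coprime (d m) (d n)) (n : ℕ) (s : Multiset ℚ)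
    (hs : ∀ a ∈ s, ∃ k, a = 1 / (d k : ℚ)) :
    ∃ (a : ℤ) (D : ℕ), 0 < D ∧ Nat.Coprime (d n) D ∧
      s.sum = (s.count (1 / (d n : ℚ)) : ℚ) / (d n : ℚ) + (a : ℚ) / (D : ℚ) := by
  classical
  induction s using Multiset.induction_on with
  | empty => exact ⟨0, 1, by simp⟩
  | cons x t ih =>
    obtain ⟨a, D, hD, hcop, he⟩ := ih (fun a ha => hs a (Multiset.mem_cons_of_mem ha))
    obtain ⟨k, hk⟩ := hs x (Multiset.mem_cons_self x t)
    have hdn : (d n : ℚ) ≠ 0 := by exact_mod_cast (hpos n).ne'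
    have hdk : (d k : ℚ) ≠ 0 := by exact_mod_cast (hpos k).ne'
    have hDq : (D : ℚ) ≠ 0 := by exact_mod_cast hD.ne'
    by_cases hx : 1 / (d n : ℚ) = x
    · refine ⟨a, D, hD, hcop, ?_⟩
      rw [Multiset.sum_cons, he, ← hx, Multiset.count_cons_self]
      push_cast
      ring
    · have hkn : n ≠ k := by
        rintro rfl
        exact hx hk.symm
      refine ⟨a * d k + D, D * d k, Nat.mul_pos hD (hpos k), hcop.mul_right (hc n k hkn), ?_⟩
      rw [Multiset.sum_cons, he, Multiset.count_cons_of_ne hx, hk]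
      push_cast
      field_simp
      ring

theorem aux_mod (d : ℕ → ℕ) (hpos : ∀ n, 0 < d n)
    (hc : ∀ m n, m ≠ n → Nat.Coprime (d m) (d n)) (n : ℕ) (s t : Multiset ℚ)
    (hs : ∀ a ∈ s, ∃ k, a = 1 / (d k : ℚ)) (ht : ∀ a ∈ t, ∃ k, a = 1 / (d k : ℚ))
    (hst : s.sum = t.sum) :
    s.count (1 / (d n : ℚ)) ≡ t.count (1 / (d n : ℚ)) [MOD d n] := by
  obtain ⟨a, D, hD, hcop, he⟩ := aux_sum d hpos hc n s hs
  obtain ⟨b, E, hE, hcop', he'⟩ := aux_sum d hpos hc n t ht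
  rw [he, he'] at hst
  generalize s.count (1 / (d n : ℚ)) = x at *
  generalize t.count (1 / (d n : ℚ)) = y at *
  have hdn : (d n : ℚ) ≠ 0 := by exact_mod_cast (hpos n).ne'
  have hDq : (D : ℚ) ≠ 0 := by exact_mod_cast hD.ne'
  have hEq : (E : ℚ) ≠ 0 := by exact_mod_cast hE.ne'
  have h1 : ((y : ℚ) - x) * (D * E) = d n * (a * E - b * D) := by
    field_simp at hst
    linarith
  have h2 : ((y : ℤ) - x) * ((D * E : ℕ) : ℤ) = (d n : ℤ) * (a * E - b * D) := by
    push_cast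
    exact_mod_cast h1
  rw [Nat.modEq_iff_dvd]
  have hco : IsCoprime (d n : ℤ) ((D * E : ℕ) : ℤ) :=
    Nat.isCoprime_iff_coprime.2 (hcop.mul_right hcop')
  exact hco.dvd_of_dvd_mul_right ⟨_, h2⟩

theorem aux_gen (d : ℕ → ℕ) (hpos : ∀ n, 0 < d n) (M : AddSubmonoid ℚ)
    (hM : M = AddSubmonoid.closure {q : ℚ | ∃ n, q = 1 / (d n : ℚ)}) (a : ℚ)
    (ha : PMAtom M a) : ∃ n, a = 1 / (d n : ℚ) := by
  obtain ⟨haM, ha0, hat⟩ := ha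
  have h1 := haM
  rw [hM] at h1
  obtain ⟨s, hs, rfl⟩ := AddSubmonoid.exists_multiset_of_mem_closure h1
  induction s using Multiset.induction_on with
  | empty => simp at ha0
  | cons x t _ =>
    obtain ⟨k, hk⟩ := hs x (Multiset.mem_cons_self x t)
    have hdk : (d k : ℚ) ≠ 0 := by exact_mod_cast (hpos k).ne'
    have hx0 : x ≠ 0 := by rw [hk]; positivity
    have hxM : x ∈ M := by
      rw [hM]; exact AddSubmonoid.subset_closure ⟨k, hk⟩
    have htM : t.sum ∈ M := by
      rw [hM]
      exact AddSubmonoid.multiset_sum_mem _ _ (fun a ha =>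
        AddSubmonoid.subset_closure (hs a (Multiset.mem_cons_of_mem ha)))
    rcases hat x t.sum hxM htM (Multiset.sum_cons x t) with h | h
    · exact absurd h hx0
    · exact ⟨k, by rw [Multiset.sum_cons, h, add_zero, hk]⟩

theorem aux_atom_s17 (d : ℕ → ℕ) (hpos : ∀ n, 0 < d n)
    (hc : ∀ m n, m ≠ n → Nat.Coprime (d m) (d n)) (M : AddSubmonoid ℚ)
    (hM : M = AddSubmonoid.closure {q : ℚ | ∃ n, q = 1 / (d n : ℚ)}) (n : ℕ)
    (hn : 2 ≤ d n) : PMAtom M (1 / (d n : ℚ)) := by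
  have hdn : (d n : ℚ) ≠ 0 := by exact_mod_cast (hpos n).ne'
  have key : ∀ s : Multiset ℚ, (∀ a ∈ s, ∃ k, a = 1 / (d k : ℚ)) → 0 ≤ s.sum := by
    intro s hs
    refine Multiset.sum_nonneg fun a ha => ?_
    obtain ⟨k, rfl⟩ := hs a ha
    positivity
  have key2 : ∀ s : Multiset ℚ, (∀ a ∈ s, ∃ k, a = 1 / (d k : ℚ)) → 1 / (d n : ℚ) ∈ s →
      1 / (d n : ℚ) ≤ s.sum := by
    intro s hs hm
    obtain ⟨t, rfl⟩ := Multiset.exists_cons_of_mem hm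
    have := key t (fun a ha => hs a (Multiset.mem_cons_of_mem ha))
    rw [Multiset.sum_cons]
    linarith
  refine ⟨?_, by positivity, ?_⟩
  · rw [hM]; exact AddSubmonoid.subset_closure ⟨n, rfl⟩
  intro q r hq hr h
  rw [hM] at hq hr
  obtain ⟨s, hs, rfl⟩ := AddSubmonoid.exists_multiset_of_mem_closure hq
  obtain ⟨t, ht, rfl⟩ := AddSubmonoid.exists_multiset_of_mem_closure hr
  have hst : ∀ a ∈ s + t, ∃ k, a = 1 / (d k : ℚ) := by
    intro a ha
    rcases Multiset.mem_add.1 ha with h | h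
    · exact hs a h
    · exact ht a h
  have hmod := aux_mod d hpos hc n (s + t) {1 / (d n : ℚ)} hst
    (by intro a ha; exact ⟨n, Multiset.mem_singleton.1 ha⟩)
    (by rw [Multiset.sum_add, Multiset.sum_singleton, h])
  rw [Multiset.count_singleton_self] at hmod
  have hmem : 1 / (d n : ℚ) ∈ s + t := by
    rw [← Multiset.count_pos, Nat.pos_iff_ne_zero]
    intro h0
    rw [h0] at hmod
    have h3 := (Nat.modEq_iff_dvd' (by omega)).1 hmod
    have := Nat.le_of_dvd (by omega) h3
    omega
  have hs0 := key s hs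
  have ht0 := key t ht
  rcases Multiset.mem_add.1 hmem with h1 | h1
  · right
    have := key2 s hs h1
    linarith
  · left
    have := key2 t ht h1
    linarith

theorem aux_le (d : ℕ → ℕ) (hpos : ∀ n, 0 < d n) (M : AddSubmonoid ℚ) (q : ℚ)
    (hq : ¬ ∃ q' ∈ M, q = 1 + q') (n : ℕ) (s : Multiset ℚ)
    (hs : ∀ a ∈ s, PMAtom M a) (hsum : s.sum = q) : s.count (1 / (d n : ℚ)) < d n := by
  by_contra! hlt
  have hdn : (d n : ℚ) ≠ 0 := by exact_mod_cast (hpos n).ne'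
  rw [Multiset.le_count_iff_replicate_le] at hlt
  obtain ⟨u, rfl⟩ := Multiset.le_iff_exists_add.1 hlt
  refine hq ⟨u.sum, AddSubmonoid.multiset_sum_mem _ _ (fun a ha =>
    (hs a (Multiset.mem_add.2 (Or.inr ha))).1), ?_⟩
  rw [← hsum, Multiset.sum_add, Multiset.sum_replicate, nsmul_eq_mul]
  field_simp

/-- let `M` be an atomic reciprocal Puiseux monoid and `q ∈ M`
nonzero. If `1` divides `q` in `M` then `L_M(q)` is infinite; if not, then `q` has
exactly one factorization, so `|L_M(q)| = 1`. In particular `|L_M(q)| ∈ {1, ∞}`. -/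
theorem stmt17 (M : AddSubmonoid ℚ) (hM : Reciprocal M) (hA : PMAtomic M)
    (q : ℚ) (hq : q ∈ M) (hq0 : q ≠ 0) :
    ((∃ q' ∈ M, q = 1 + q') → (LengthSet M q).Infinite) ∧
    (¬ (∃ q' ∈ M, q = 1 + q') →
      ∃! s : Multiset ℚ, (∀ a ∈ s, PMAtom M a) ∧ s.sum = q) ∧
    ((LengthSet M q).Infinite ∨ ∃ ℓ : ℕ, LengthSet M q = {ℓ}) := by
  obtain ⟨d, hmono, hpos, hc, hgen⟩ := hM
  have hinf : (∃ q' ∈ M, q = 1 + q') → (LengthSet M q).Infinite := by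
    rintro ⟨q', hq', rfl⟩
    obtain ⟨s, hs, hsum⟩ : ∃ s : Multiset ℚ, (∀ a ∈ s, PMAtom M a) ∧ s.sum = q' := by
      by_cases h0 : q' = 0
      · exact ⟨0, by simp, by simp [h0]⟩
      · exact hA q' hq' h0
    refine Set.infinite_of_injective_forall_mem (f := fun n : ℕ => d (n + 1) + s.card) ?_ ?_
    · intro a b hab
      have h1 : d (a + 1) = d (b + 1) := Nat.add_right_cancel hab
      exact Nat.succ_injective (hmono.injective h1)
    · intro n
      have h2 : 2 ≤ d (n + 1) := by
        have h3 := hmono (Nat.lt_succ_self n)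
        have h4 := hpos n
        simp only [Nat.succ_eq_add_one] at h3
        omega
      have hdn : (d (n + 1) : ℚ) ≠ 0 := by exact_mod_cast (hpos (n + 1)).ne'
      refine ⟨Multiset.replicate (d (n + 1)) (1 / (d (n + 1) : ℚ)) + s, ?_, ?_, by simp⟩
      · intro a ha
        rcases Multiset.mem_add.1 ha with h | h
        · rw [Multiset.eq_of_mem_replicate h]
          exact aux_atom_s17 d hpos hc M hgen (n + 1) h2
        · exact hs a h
      · rw [Multiset.sum_add, Multiset.sum_replicate, nsmul_eq_mul, hsum]
        field_simp
  have huni : ¬ (∃ q' ∈ M, q = 1 + q') →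
      ∃! s : Multiset ℚ, (∀ a ∈ s, PMAtom M a) ∧ s.sum = q := by
    intro hnd
    obtain ⟨s, hs, hsum⟩ := hA q hq hq0
    refine ⟨s, ⟨hs, hsum⟩, ?_⟩
    rintro t ⟨ht, htsum⟩
    have gs := fun a ha => aux_gen d hpos M hgen a (hs a ha)
    have gt := fun a ha => aux_gen d hpos M hgen a (ht a ha)
    ext a
    by_cases hex : ∃ n, a = 1 / (d n : ℚ)
    · obtain ⟨n, rfl⟩ := hex
      exact Nat.ModEq.eq_of_lt_of_lt
        (aux_mod d hpos hc n t s gt gs (htsum.trans hsum.symm))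
        (aux_le d hpos M q hnd n t ht htsum) (aux_le d hpos M q hnd n s hs hsum)
    · rw [Multiset.count_eq_zero_of_notMem (fun h => hex (gt a h)),
        Multiset.count_eq_zero_of_notMem (fun h => hex (gs a h))]
  refine ⟨hinf, huni, ?_⟩
  by_cases h : ∃ q' ∈ M, q = 1 + q'
  · exact Or.inl (hinf h)
  · right
    obtain ⟨s, ⟨hs, hsum⟩, hu⟩ := huni h
    refine ⟨s.card, ?_⟩
    ext l
    constructor
    · rintro ⟨t, ht, htsum, rfl⟩
      rw [hu t ⟨ht, htsum⟩]
      rfl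
    · rintro rfl
      exact ⟨s, hs, hsum, rfl⟩
end

section
/- Let (q_n)_{n≥1} be a sequence of positive rationals, and let (p_n)_{n≥1} be a sequence of prime numbers such that for every n, p_n divides d(q_n) but p_n does not divide d(q_k) for every k ≠ n. Then the Puiseux monoid M generated by {q_n : n ∈ ℕ} is a length-finite-factorization monoid (LFFM): M is atomic and, for every x ∈ M and every ℓ ∈ ℕ, the set of factorizations of x of length ℓ is finite. -/
/-- The additive group of rationals whose denominator is prime to `p`. -/
def pIntegral (p : ℕ) (hp : p.Prime) : AddSubgroup ℚ where
  carrier := {r | ¬ p ∣ r.den}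
  zero_mem' := by
    simp only [Set.mem_setOf_eq, Rat.den_ofNat, Nat.dvd_one]
    exact hp.one_lt.ne'
  add_mem' := by
    intro a b ha hb h
    rcases (hp.dvd_mul).1 (h.trans (Rat.add_den_dvd a b)) with h | h
    · exact ha h
    · exact hb h
  neg_mem' := by
    intro a ha
    simpa using ha

lemma dvd_of_mul_mem (p : ℕ) (hp : p.Prime) (r : ℚ) (hr : p ∣ r.den) (m : ℤ)
    (h : (m : ℚ) * r ∈ pIntegral p hp) : (p : ℤ) ∣ m := by
  have h1 : ¬ p ∣ ((m : ℚ) * r).den := h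
  set y := (m : ℚ) * r with hy
  have e : m * r.num * y.den = y.num * r.den := by
    have a1 : (r.num : ℚ) = r * r.den := (Rat.mul_den_eq_num r).symm
    have a2 : (y.num : ℚ) = y * y.den := (Rat.mul_den_eq_num y).symm
    have : (m : ℚ) * r.num * y.den = y.num * r.den := by
      rw [a1, a2, hy]; ring
    exact_mod_cast this
  have hpi : Prime (p : ℤ) := Nat.prime_iff_prime_int.1 hp
  have hd : (p : ℤ) ∣ m * r.num * y.den := by
    rw [e]; exact Dvd.dvd.mul_left (by exact_mod_cast hr) _
  rcases hpi.dvd_or_dvd hd with h2 | h2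
  · rcases hpi.dvd_or_dvd h2 with h3 | h3
    · exact h3
    · exfalso
      have h4 : p ∣ r.num.natAbs := Int.natCast_dvd.1 h3
      have := Nat.dvd_gcd h4 hr
      rw [r.reduced.gcd_eq_one] at this
      exact hp.one_lt.ne' (Nat.dvd_one.1 this)
  · exact absurd (by exact_mod_cast h2) h1


lemma sum_sub_mem (q : ℕ → ℚ) (p : ℕ → ℕ) (hp : ∀ n, (p n).Prime)
    (hndvd : ∀ n k, k ≠ n → ¬ p n ∣ (q k).den) (n : ℕ) (s : Multiset ℕ) :
    (s.map q).sum - ((s.count n : ℤ) : ℚ) * q n ∈ pIntegral (p n) (hp n) := by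
  induction s using Multiset.induction_on with
  | empty => simpa using (pIntegral (p n) (hp n)).zero_mem
  | cons k s ih =>
    by_cases hk : k = n
    · subst hk
      convert ih using 1
      simp; ring
    · have : q k ∈ pIntegral (p n) (hp n) := hndvd n k hk
      convert add_mem this ih using 1
      simp [Multiset.count_cons_of_ne (Ne.symm hk)]; ring

lemma count_key (q : ℕ → ℚ) (p : ℕ → ℕ) (hp : ∀ n, (p n).Prime)
    (hdvd : ∀ n, p n ∣ (q n).den)
    (hndvd : ∀ n k, k ≠ n → ¬ p n ∣ (q k).den) (n : ℕ) (s t : Multiset ℕ)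
    (h : (s.map q).sum = (t.map q).sum) :
    (p n : ℤ) ∣ (s.count n : ℤ) - t.count n := by
  apply dvd_of_mul_mem (p n) (hp n) (q n) (hdvd n)
  convert sub_mem (sum_sub_mem q p hp hndvd n t) (sum_sub_mem q p hp hndvd n s) using 1
  rw [h]; push_cast; ring

lemma mem_closure_range (q : ℕ → ℚ) (x : ℚ)
    (hx : x ∈ AddSubmonoid.closure (Set.range q)) :
    ∃ s : Multiset ℕ, (s.map q).sum = x := by
  induction hx using AddSubmonoid.closure_induction with
  | mem x hx => obtain ⟨n, rfl⟩ := hx; exact ⟨{n}, by simp⟩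
  | zero => exact ⟨0, by simp⟩
  | add x y _ _ hx hy =>
    obtain ⟨s, rfl⟩ := hx
    obtain ⟨t, rfl⟩ := hy
    exact ⟨s + t, by simp⟩

lemma sum_nn (q : ℕ → ℚ) (hq : ∀ n, 0 < q n) (s : Multiset ℕ) : 0 ≤ (s.map q).sum := by
  apply Multiset.sum_nonneg
  intro x hx
  obtain ⟨n, _, rfl⟩ := Multiset.mem_map.1 hx
  exact (hq n).le

lemma le_sum (q : ℕ → ℚ) (hq : ∀ n, 0 < q n) (s : Multiset ℕ) (n : ℕ) (h : n ∈ s) :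
    q n ≤ (s.map q).sum := by
  obtain ⟨t, rfl⟩ := Multiset.exists_cons_of_mem h
  have := sum_nn q hq t
  simp; linarith

lemma sum_mem_cl (q : ℕ → ℚ) (s : Multiset ℕ) :
    (s.map q).sum ∈ AddSubmonoid.closure (Set.range q) := by
  apply AddSubmonoid.multiset_sum_mem
  intro x hx
  obtain ⟨n, _, rfl⟩ := Multiset.mem_map.1 hx
  exact AddSubmonoid.subset_closure ⟨n, rfl⟩


/-- if `(q n)` are positive rationals and `(p n)` primes with
`p n ∣ den (q n)` but `p n ∤ den (q k)` for `k ≠ n`, then `M = ⟨q n⟩` is a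
length-finite-factorization monoid. -/
theorem stmt18 (q : ℕ → ℚ) (hq : ∀ n, 0 < q n)
    (p : ℕ → ℕ) (hp : ∀ n, (p n).Prime)
    (hdvd : ∀ n, p n ∣ (q n).den)
    (hndvd : ∀ n k, k ≠ n → ¬ p n ∣ (q k).den)
    (M : AddSubmonoid ℚ) (hM : M = AddSubmonoid.closure (Set.range q)) :
    LFFM M := by
  subst hM
  have hatom : ∀ n, PMAtom (AddSubmonoid.closure (Set.range q)) (q n) := by
    intro n
    refine ⟨AddSubmonoid.subset_closure ⟨n, rfl⟩, (hq n).ne', ?_⟩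
    intro y z hy hz h
    obtain ⟨s, rfl⟩ := mem_closure_range q y hy
    obtain ⟨t, rfl⟩ := mem_closure_range q z hz
    have key := count_key q p hp hdvd hndvd n {n} (s + t) (by simpa using h)
    have hs := sum_nn q hq s
    have ht := sum_nn q hq t
    by_cases h1 : n ∈ s
    · right
      have := le_sum q hq s n h1
      linarith
    by_cases h2 : n ∈ t
    · left
      have := le_sum q hq t n h2
      linarith
    exfalso
    rw [Multiset.count_add, Multiset.count_eq_zero_of_notMem h1,
      Multiset.count_eq_zero_of_notMem h2] at key
    simp only [Multiset.count_singleton_self] at key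
    have : p n ∣ 1 := by exact_mod_cast (by simpa using key : (p n : ℤ) ∣ 1)
    exact (hp n).one_lt.ne' (Nat.dvd_one.1 this)
  have hrange : ∀ a, PMAtom (AddSubmonoid.closure (Set.range q)) a → ∃ n, q n = a := by
    rintro a ⟨ha, h0, hir⟩
    obtain ⟨s, rfl⟩ := mem_closure_range q a ha
    rcases Multiset.empty_or_exists_mem s with rfl | ⟨n, hn⟩
    · simp at h0
    · obtain ⟨t, rfl⟩ := Multiset.exists_cons_of_mem hn
      refine ⟨n, ?_⟩
      rcases hir (q n) (t.map q).sum (AddSubmonoid.subset_closure ⟨n, rfl⟩)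
        (sum_mem_cl q t) (by simp) with h | h
      · exact absurd h (hq n).ne'
      · simp [h]
  have pinj : Function.Injective p := by
    intro a b hab
    by_contra hne
    exact hndvd a b (Ne.symm hne) (hab ▸ hdvd b)
  refine ⟨?_, ?_⟩
  · intro x hx _
    obtain ⟨s, rfl⟩ := mem_closure_range q x hx
    refine ⟨s.map q, ?_, rfl⟩
    intro a ha
    obtain ⟨n, _, rfl⟩ := Multiset.mem_map.1 ha
    exact hatom n
  · intro x _ l
    have hT : {u : Multiset ℕ | (u.map q).sum = x ∧ Multiset.card u = l}.Finite := by
      rcases Set.eq_empty_or_nonempty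
        {u : Multiset ℕ | (u.map q).sum = x ∧ Multiset.card u = l} with he | ⟨u0, h0, _⟩
      · rw [he]; exact Set.finite_empty
      have hfin : {n | p n ≤ l}.Finite := (Set.finite_Iic l).preimage pinj.injOn
      refine (Set.finite_Iic (l • (u0.toFinset ∪ hfin.toFinset).val)).subset ?_
      rintro u ⟨hu, hc⟩
      rw [Set.mem_Iic, Multiset.le_iff_count]
      intro n
      have hcn : u.count n ≤ l := hc ▸ Multiset.count_le_card n u
      rw [Multiset.count_nsmul]
      by_cases hn : n ∈ u0.toFinset ∪ hfin.toFinset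
      · rw [Multiset.count_eq_one_of_mem (Finset.nodup _) hn]
        simpa using hcn
      · simp only [Finset.mem_union, Multiset.mem_toFinset, Set.Finite.mem_toFinset,
          Set.mem_setOf_eq, not_or, not_le] at hn
        have key := count_key q p hp hdvd hndvd n u u0 (hu.trans h0.symm)
        rw [Multiset.count_eq_zero_of_notMem hn.1] at key
        have k2 : p n ∣ u.count n := by exact_mod_cast (by simpa using key : (p n : ℤ) ∣ u.count n)
        rw [Nat.eq_zero_of_dvd_of_lt k2 (by omega)]
        exact Nat.zero_le _
    refine (hT.image (Multiset.map q)).subset ?_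
    rintro s ⟨hs, hsum, hcard⟩
    have : ∃ u : Multiset ℕ, u.map q = s := by
      clear hsum hcard
      induction s using Multiset.induction_on with
      | empty => exact ⟨0, rfl⟩
      | cons a s ih =>
        obtain ⟨u, hu⟩ := ih (fun b hb => hs b (Multiset.mem_cons_of_mem hb))
        obtain ⟨n, hn⟩ := hrange a (hs a (Multiset.mem_cons_self a s))
        exact ⟨n ::ₘ u, by simp [hu, hn]⟩
    obtain ⟨u, rfl⟩ := this
    exact ⟨u, ⟨hsum, by simpa using hcard⟩, rfl⟩
end

section
/- Every almost reciprocal Puiseux monoid is a length-finite-factorization monoid (LFFM). In particular, the Grams' monoid ⟨1/(2^n p_n) : n ∈ ℕ⟩, where (p_n)_{n≥1} is the strictly increasing enumeration of the odd primes, is a Puiseux monoid satisfying the length-finite-factorization condition that does not satisfy the ACCP. -/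
theorem HH (c e d : ℕ → ℕ) (he : ∀ i, 0 < e i) (hde : ∀ i, d i ∣ e i)
    (hcop : ∀ n j, j ≠ n → Nat.Coprime (d n) (e j)) (hcd : ∀ n, Nat.Coprime (c n) (d n))
    (k k' : ℕ →₀ ℕ)
    (h : Finsupp.linearCombination ℕ (fun i => (c i : ℚ) / (e i : ℚ)) k
       = Finsupp.linearCombination ℕ (fun i => (c i : ℚ) / (e i : ℚ)) k') (n : ℕ) :
    k n ≡ k' n [MOD d n] := by
  classical
  set S : Finset ℕ := insert n (k.support ∪ k'.support) with hS
  have hsum : ∀ f : ℕ →₀ ℕ, f.support ⊆ S →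
      Finsupp.linearCombination ℕ (fun i => (c i : ℚ) / (e i : ℚ)) f
        = ∑ i ∈ S, (f i : ℚ) * ((c i : ℚ) / (e i : ℚ)) := by
    intro f hf
    rw [Finsupp.linearCombination_apply, Finsupp.sum_of_support_subset f hf _ (by simp)]
    simp
  rw [hsum k (by intro x hx; simp only [hS, Finset.mem_insert, Finset.mem_union]; tauto),
    hsum k' (by intro x hx; simp only [hS, Finset.mem_insert, Finset.mem_union]; tauto)] at h
  have h2 : ∑ i ∈ S, ((k i : ℤ) - k' i) * (c i * ∏ j ∈ S.erase i, (e j : ℤ)) = 0 := by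
    have h3 : ∑ i ∈ S, (((k i : ℚ) - k' i) * ((c i : ℚ) / e i)) * ∏ j ∈ S, (e j : ℚ) = 0 := by
      rw [← Finset.sum_mul]
      simp only [sub_mul, Finset.sum_sub_distrib, h, sub_self, zero_mul]
    have h4 : ∑ i ∈ S, ((k i : ℚ) - k' i) * (c i * ∏ j ∈ S.erase i, (e j : ℚ)) = 0 := by
      rw [← h3]
      refine Finset.sum_congr rfl fun i hi => ?_
      rw [← Finset.mul_prod_erase S _ hi]
      have : (e i : ℚ) ≠ 0 := by exact_mod_cast (he i).ne'
      field_simp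
    exact_mod_cast h4
  have hn : n ∈ S := by simp [hS]
  rw [← Finset.add_sum_erase S _ hn] at h2
  have h5 : (d n : ℤ) ∣ ∑ i ∈ S.erase n, ((k i : ℤ) - k' i) * (c i * ∏ j ∈ S.erase i, (e j : ℤ)) := by
    refine Finset.dvd_sum fun i hi => ?_
    have h6 : n ∈ S.erase i := by
      simp only [Finset.mem_erase] at hi ⊢
      exact ⟨fun h => hi.1 h.symm, hn⟩
    refine Dvd.dvd.mul_left (Dvd.dvd.mul_left ?_ _) _
    exact (Int.natCast_dvd_natCast.2 (hde n)).trans (Finset.dvd_prod_of_mem (fun j => (e j : ℤ)) h6)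
  have h7 : (d n : ℤ) ∣ ((k n : ℤ) - k' n) * (c n * ∏ j ∈ S.erase n, (e j : ℤ)) := by
    rw [eq_neg_of_add_eq_zero_left h2]
    exact (dvd_neg).2 h5
  have h8 : IsCoprime (d n : ℤ) (c n * ∏ j ∈ S.erase n, (e j : ℤ)) := by
    refine IsCoprime.mul_right (Nat.isCoprime_iff_coprime.2 (hcd n).symm) ?_
    refine IsCoprime.prod_right fun j hj => Nat.isCoprime_iff_coprime.2 (hcop n j ?_)
    exact (Finset.mem_erase.1 hj).1
  have h9 := h8.dvd_of_dvd_mul_right h7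
  exact ((Nat.modEq_iff_dvd).2 h9).symm

theorem mem_cl (a : ℕ → ℚ) (x : ℚ) (hx : x ∈ AddSubmonoid.closure {q : ℚ | ∃ n, q = a n}) :
    ∃ k : ℕ →₀ ℕ, x = Finsupp.linearCombination ℕ a k := by
  induction hx using AddSubmonoid.closure_induction with
  | mem x hx => obtain ⟨n, rfl⟩ := hx; exact ⟨Finsupp.single n 1, by simp⟩
  | zero => exact ⟨0, by simp⟩
  | add x y _ _ h1 h2 =>
    obtain ⟨k, rfl⟩ := h1
    obtain ⟨l, rfl⟩ := h2
    exact ⟨k + l, by simp⟩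

theorem cl_nonneg (a : ℕ → ℚ) (ha : ∀ n, 0 < a n) (x : ℚ)
    (hx : x ∈ AddSubmonoid.closure {q : ℚ | ∃ n, q = a n}) : 0 ≤ x := by
  induction hx using AddSubmonoid.closure_induction with
  | mem x hx => obtain ⟨n, rfl⟩ := hx; exact (ha n).le
  | zero => exact le_rfl
  | add x y _ _ h1 h2 => exact add_nonneg h1 h2

/-- any element is zero or a generator plus an element. -/
theorem cl_split (a : ℕ → ℚ) (x : ℚ) (hx : x ∈ AddSubmonoid.closure {q : ℚ | ∃ n, q = a n}) :
    x = 0 ∨ ∃ n, ∃ y ∈ AddSubmonoid.closure {q : ℚ | ∃ n, q = a n}, x = a n + y := by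
  induction hx using AddSubmonoid.closure_induction with
  | mem x hx => obtain ⟨n, rfl⟩ := hx; exact Or.inr ⟨n, 0, zero_mem _, by simp⟩
  | zero => exact Or.inl rfl
  | add x y hx hy h1 h2 =>
    rcases h1 with rfl | ⟨n, z, hz, rfl⟩
    · simpa using h2
    · exact Or.inr ⟨n, z + y, add_mem hz hy, by ring⟩

theorem atom_gen (a : ℕ → ℚ) (ha : ∀ n, 0 < a n) (x : ℚ)
    (hx : PMAtom (AddSubmonoid.closure {q : ℚ | ∃ n, q = a n}) x) : ∃ n, a n = x := by
  obtain ⟨h1, h2, h3⟩ := hx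
  rcases cl_split a x h1 with h | ⟨n, y, hy, h⟩
  · exact absurd h h2
  · rcases h3 _ _ (AddSubmonoid.subset_closure ⟨n, rfl⟩) hy h with h4 | h4
    · exact absurd h4 (ha n).ne'
    · exact ⟨n, by rw [h, h4, add_zero]⟩

theorem lc_nonneg (a : ℕ → ℚ) (ha : ∀ n, 0 < a n) (k : ℕ →₀ ℕ) :
    0 ≤ Finsupp.linearCombination ℕ a k := by
  rw [Finsupp.linearCombination_apply]
  exact Finset.sum_nonneg fun i _ => nsmul_nonneg (ha i).le _

theorem lc_ge (a : ℕ → ℚ) (ha : ∀ n, 0 < a n) (k : ℕ →₀ ℕ) (n : ℕ) (hk : k n ≠ 0) :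
    a n ≤ Finsupp.linearCombination ℕ a k := by
  have h : k = Finsupp.single n 1 + (k - Finsupp.single n 1) := by
    ext i
    by_cases hi : n = i
    · subst hi; simp; omega
    · simp [Finsupp.single_apply, hi]
  rw [h, map_add]
  have := lc_nonneg a ha (k - Finsupp.single n 1)
  simp only [Finsupp.linearCombination_single, one_smul]
  linarith

theorem mset_lift (a : ℕ → ℚ) (s : Multiset ℚ) (hs : ∀ x ∈ s, ∃ n, a n = x) :
    ∃ t : Multiset ℕ, t.map a = s := by
  induction s using Multiset.induction_on with
  | empty => exact ⟨0, rfl⟩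
  | cons x s ih =>
    obtain ⟨t, ht⟩ := ih fun y hy => hs y (Multiset.mem_cons_of_mem hy)
    obtain ⟨n, hn⟩ := hs x (Multiset.mem_cons_self x s)
    exact ⟨n ::ₘ t, by simp [ht, hn]⟩

theorem lc_mset (a : ℕ → ℚ) (t : Multiset ℕ) :
    Finsupp.linearCombination ℕ a (Multiset.toFinsupp t) = (t.map a).sum := by
  induction t using Multiset.induction_on with
  | empty => simp
  | cons x s ih =>
    rw [← Multiset.singleton_add, map_add, map_add, ih]
    simp

theorem main_lffm (a : ℕ → ℚ) (ha : ∀ n, 0 < a n) (d : ℕ → ℕ) (hd : StrictMono d)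
    (hd0 : ∀ n, 0 < d n)
    (H : ∀ k k' : ℕ →₀ ℕ, Finsupp.linearCombination ℕ a k = Finsupp.linearCombination ℕ a k' →
      ∀ n, k n ≡ k' n [MOD d n]) :
    LFFM (AddSubmonoid.closure {q : ℚ | ∃ n, q = a n}) := by
  classical
  have hdn : ∀ n, n < d n := by
    intro n
    induction n with
    | zero => exact hd0 0
    | succ n ih => have := hd (Nat.lt_add_one n); omega
  have hgen : ∀ n, a n ∈ AddSubmonoid.closure {q : ℚ | ∃ n, q = a n} :=
    fun n => AddSubmonoid.subset_closure ⟨n, rfl⟩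
  have hatom : ∀ n, 1 ≤ n → PMAtom (AddSubmonoid.closure {q : ℚ | ∃ n, q = a n}) (a n) := by
    intro n hn
    refine ⟨hgen n, (ha n).ne', ?_⟩
    intro q r hq hr hqr
    have hq0 := cl_nonneg a ha q hq
    have hr0 := cl_nonneg a ha r hr
    obtain ⟨k, rfl⟩ := mem_cl a q hq
    obtain ⟨l, rfl⟩ := mem_cl a r hr
    have h1 := H (Finsupp.single n 1) (k + l) (by rw [map_add, ← hqr]; simp) n
    have h2 : k n ≠ 0 ∨ l n ≠ 0 := by
      by_contra hc
      push Not at hc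
      have h3 := hdn n
      simp only [Finsupp.single_eq_same, Finsupp.add_apply, hc.1, hc.2] at h1
      have := (Nat.modEq_zero_iff_dvd.1 h1)
      have := Nat.le_of_dvd one_pos this
      omega
    rcases h2 with h2 | h2
    · have := lc_ge a ha k n h2
      right; linarith
    · have := lc_ge a ha l n h2
      left; linarith
  -- sums of generators with index at least one
  have hsm : ∀ k : ℕ →₀ ℕ, k 0 = 0 → ∃ s : Multiset ℚ,
      (∀ x ∈ s, PMAtom (AddSubmonoid.closure {q : ℚ | ∃ n, q = a n}) x) ∧
      s.sum = Finsupp.linearCombination ℕ a k := by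
    intro k hk
    refine ⟨(Finsupp.toMultiset k).map a, ?_, ?_⟩
    · intro x hx
      obtain ⟨n, hn, rfl⟩ := Multiset.mem_map.1 hx
      refine hatom n ?_
      rw [Finsupp.mem_toMultiset, Finsupp.mem_support_iff] at hn
      rcases Nat.eq_zero_or_pos n with rfl | h
      · exact absurd hk hn
      · exact h
    · rw [← lc_mset]; simp
  have hzero : ∃ s : Multiset ℚ,
      (∀ x ∈ s, PMAtom (AddSubmonoid.closure {q : ℚ | ∃ n, q = a n}) x) ∧ s.sum = a 0 := by
    by_cases h0 : PMAtom (AddSubmonoid.closure {q : ℚ | ∃ n, q = a n}) (a 0)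
    · exact ⟨{a 0}, by simpa using h0, by simp⟩
    · have : ∃ q r : ℚ, q ∈ AddSubmonoid.closure {q : ℚ | ∃ n, q = a n} ∧
          r ∈ AddSubmonoid.closure {q : ℚ | ∃ n, q = a n} ∧ a 0 = q + r ∧ q ≠ 0 ∧ r ≠ 0 := by
        by_contra hc
        push Not at hc
        refine h0 ⟨hgen 0, (ha 0).ne', fun q r hq hr h => ?_⟩
        by_cases hq0 : q = 0
        · exact Or.inl hq0
        · exact Or.inr (hc q r hq hr h hq0)
      obtain ⟨q, r, hq, hr, hqr, hq0, hr0⟩ := this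
      have hq1 := lt_of_le_of_ne (cl_nonneg a ha q hq) hq0.symm
      have hr1 := lt_of_le_of_ne (cl_nonneg a ha r hr) hr0.symm
      obtain ⟨k, rfl⟩ := mem_cl a q hq
      obtain ⟨l, rfl⟩ := mem_cl a r hr
      have hk : k 0 = 0 := by
        by_contra h
        have := lc_ge a ha k 0 h
        linarith
      have hl : l 0 = 0 := by
        by_contra h
        have := lc_ge a ha l 0 h
        linarith
      obtain ⟨s, hs, hs'⟩ := hsm (k + l) (by simp [hk, hl])
      exact ⟨s, hs, by rw [hs', hqr, map_add]⟩
  refine ⟨?_, ?_⟩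
  · intro x hx _
    induction hx using AddSubmonoid.closure_induction with
    | mem x hx =>
      obtain ⟨n, rfl⟩ := hx
      rcases Nat.eq_zero_or_pos n with rfl | h
      · exact hzero
      · exact ⟨{a n}, by simpa using hatom n h, by simp⟩
    | zero => exact ⟨0, by simp, by simp⟩
    | add x y hx hy h1 h2 =>
      by_cases hx0 : x = 0
      · subst hx0
        by_cases hy0 : y = 0
        · exact ⟨0, by simp, by simp [hy0]⟩
        · simpa using h2 hy0
      · by_cases hy0 : y = 0
        · simpa [hy0] using h1 hx0
        · obtain ⟨s, hs, rfl⟩ := h1 hx0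
          obtain ⟨t, ht, rfl⟩ := h2 hy0
          refine ⟨s + t, ?_, by simp⟩
          intro b hb
          rcases Multiset.mem_add.1 hb with hb | hb
          · exact hs b hb
          · exact ht b hb
  · intro x hx ℓ
    obtain ⟨k, hk⟩ := mem_cl a x hx
    set F : Finset ℕ := k.support ∪ Finset.range ℓ with hF
    refine (Set.finite_Iic ((ℓ • F.val).map a)).subset ?_
    rintro s ⟨hs1, hs2, hs3⟩
    obtain ⟨t, rfl⟩ := mset_lift a s fun y hy => atom_gen a ha y (hs1 y hy)
    rw [Multiset.card_map] at hs3
    refine Multiset.map_le_map ?_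
    rw [Multiset.le_iff_count]
    intro n
    have hc : t.count n ≤ ℓ := hs3 ▸ Multiset.count_le_card n t
    rw [Multiset.count_nsmul]
    by_cases hn : n ∈ F
    · rw [Multiset.count_eq_one_of_mem F.nodup hn]; omega
    · simp only [hF, Finset.mem_union, Finset.mem_range, Finsupp.mem_support_iff] at hn
      push Not at hn
      have h1 := H (Multiset.toFinsupp t) k (by rw [lc_mset, hs2, hk]) n
      rw [hn.1, Multiset.toFinsupp_apply] at h1
      have h2 := Nat.modEq_zero_iff_dvd.1 h1
      have h3 := Nat.eq_zero_of_dvd_of_lt h2 (by have := hdn n; omega)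
      omega


/-- every almost reciprocal Puiseux monoid is an LFFM; in particular,
the Grams' monoid `G = ⟨1 / (2 ^ n * p n)⟩`, where `(p n)` is the strictly
increasing enumeration of the odd primes, satisfies the length-finite-factorization
condition but does not satisfy the ACCP. -/
theorem stmt19 (p : ℕ → ℕ) (hmono : StrictMono p)
    (hp : ∀ n, (p n).Prime ∧ p n ≠ 2)
    (hsurj : ∀ r : ℕ, r.Prime → r ≠ 2 → ∃ n, p n = r)
    (G : AddSubmonoid ℚ)
    (hG : G = AddSubmonoid.closure
      {x : ℚ | ∃ n : ℕ, x = 1 / ((2 : ℚ) ^ (n + 1) * (p n : ℚ))}) :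
    (∀ M : AddSubmonoid ℚ, AlmostReciprocal M → LFFM M) ∧
    (LFFM G ∧ ¬ SatisfiesACCP G) := by
  have hpp : ∀ n, 0 < p n := fun n => (hp n).1.pos
  refine ⟨?_, ?_, ?_⟩
  · rintro M ⟨c, d, hd, hd0, hcop, hc0, hcd, rfl⟩
    refine main_lffm (fun n => (c n : ℚ) / (d n : ℚ)) ?_ d hd hd0 ?_
    · intro n
      have h1 : (0 : ℚ) < c n := by exact_mod_cast hc0 n
      have h2 : (0 : ℚ) < d n := by exact_mod_cast hd0 n
      exact div_pos h1 h2
    · exact HH c d d hd0 (fun _ => dvd_rfl) (fun n j h => hcop n j h.symm) hcd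
  · have e : (fun n : ℕ => 1 / ((2 : ℚ) ^ (n + 1) * (p n : ℚ)))
        = fun n => (((fun _ => 1 : ℕ → ℕ) n : ℕ) : ℚ)
          / (((fun n => 2 ^ (n + 1) * p n : ℕ → ℕ) n : ℕ) : ℚ) := by
      funext n; push_cast; rfl
    rw [hG]
    refine main_lffm (fun n : ℕ => 1 / ((2 : ℚ) ^ (n + 1) * (p n : ℚ))) ?_ p hmono hpp ?_
    · intro n
      have h2 : (0 : ℚ) < p n := by exact_mod_cast hpp n
      positivity
    · rw [e]
      refine HH _ _ p (fun n => ?_) (fun n => Dvd.intro_left _ rfl) ?_ (by simp)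
      · have := hpp n
        positivity
      · intro n j h
        refine Nat.Coprime.mul_right (Nat.Coprime.pow_right _ ?_) ?_
        · exact (Nat.coprime_primes (hp n).1 Nat.prime_two).2 (hp n).2
        · exact (Nat.coprime_primes (hp n).1 (hp j).1).2 fun h' => h (hmono.injective h').symm
  · intro hA
    have hmem : ∀ n : ℕ, 1 / (2 : ℚ) ^ (n + 1) ∈ G := by
      intro n
      have h1 : 1 / ((2 : ℚ) ^ (n + 1) * (p n : ℚ)) ∈ G := by
        rw [hG]; exact AddSubmonoid.subset_closure ⟨n, rfl⟩
      have h2 := nsmul_mem h1 (p n)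
      have h3 : (p n : ℚ) ≠ 0 := by exact_mod_cast (hpp n).ne'
      have h4 : p n • (1 / ((2 : ℚ) ^ (n + 1) * (p n : ℚ))) = 1 / (2 : ℚ) ^ (n + 1) := by
        rw [nsmul_eq_mul]; field_simp
      rwa [h4] at h2
    have hnn : ∀ x ∈ G, 0 ≤ x := by
      intro x hx
      rw [hG] at hx
      refine cl_nonneg (fun n : ℕ => 1 / ((2 : ℚ) ^ (n + 1) * (p n : ℚ))) ?_ x hx
      intro n
      have h2 : (0 : ℚ) < p n := by exact_mod_cast hpp n
      positivity
    obtain ⟨N, hN⟩ := hA (fun n => 1 / (2 : ℚ) ^ (n + 1)) hmem (by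
      rintro n x ⟨m, hm, rfl⟩
      refine ⟨1 / (2 : ℚ) ^ (n + 1 + 1) + m, add_mem (hmem (n + 1)) hm, ?_⟩
      simp only [pow_succ]
      field_simp
      ring)
    have h1 : 1 / (2 : ℚ) ^ (N + 1 + 1) ∈ PrincipalIdeal G (1 / (2 : ℚ) ^ (N + 1)) := by
      rw [← hN (N + 1) (Nat.le_succ N)]
      exact ⟨0, zero_mem _, by simp⟩
    obtain ⟨m, hm, h2⟩ := h1
    have h3 := hnn m hm
    have h4 : 1 / (2 : ℚ) ^ (N + 1 + 1) < 1 / (2 : ℚ) ^ (N + 1) := by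
      apply one_div_lt_one_div_of_lt (by positivity)
      exact pow_lt_pow_right₀ (by norm_num) (Nat.lt_succ_self _)
    linarith
end
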